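/- arXiv:1104.3553 — 3 statements merged into one kernel-verified Lean document; each statement's English description precedes it below -/
import Mathlib

section
/- There exists a constant C > 0 such that for every integer n ≥ 1, all self-adjoint n×n complex matrices A and B, every L ≥ 0, and every continuous function f : ℝ → ℂ satisfying |f(x) − f(y)| ≤ L·|x − y| for all x, y in σ(A) ∪ σ(B), one has ‖f(A) − f(B)‖ ≤ C · (1 + log n) · L · ‖A − B‖. -/
open MeasureTheory ENNReal

/-- `|T| = (T*T)^{1/2}` via the continuous functional calculus. -/
noncomputable def opAbs {H : Type} [NormedAddCommGroup H] [InnerProductSpace ℂ H]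
    [CompleteSpace H] (T : H →L[ℂ] H) : H →L[ℂ] H :=
  cfc Real.sqrt (star T * T)

/-- The Hilbert space `ℓ²(ℕ, ℂ)`. -/
noncomputable abbrev ellTwo : Type := lp (fun _ : ℕ => ℂ) 2

/-- Application of a function `f : ℝ → ℂ` to a (self-adjoint) operator via the
continuous functional calculus. -/
noncomputable def cfcC {H : Type} [NormedAddCommGroup H] [InnerProductSpace ℂ H]
    [CompleteSpace H] (f : ℝ → ℂ) (A : H →L[ℂ] H) : H →L[ℂ] H :=
  cfc (fun z : ℂ => f z.re) A

/-- A family of nonnegative weights of total mass at most `1` can be split, along any linear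
preorder of the indices given by `y`, into `k + 1` successive groups each of mass at most `2 / k`,
after removing at most `k` indices. -/
lemma exists_monotone_grouping {n : ℕ} (y β : Fin n → ℝ) (hβ : ∀ j, 0 ≤ β j)
    (hβ1 : ∑ j, β j ≤ 1) {k : ℕ} (hk : 0 < k) :
    ∃ (H : Finset (Fin n)) (G : Fin n → Fin (k + 1)), H.card ≤ k ∧
      (∀ i j, G i < G j → y i ≤ y j) ∧
      ∀ g, ∑ j with j ∉ H ∧ G j = g, β j ≤ 2 / k := by
  have hk' : (0 : ℝ) < k := by exact_mod_cast hk
  set key : Fin n → ℝ ×ₗ Fin n := fun j => toLex (y j, j) with hkey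
  have key_inj : Function.Injective key := fun i j h => by
    have := congrArg (fun z => (ofLex z).2) h
    simpa [hkey] using this
  set F : Fin n → ℝ := fun j => ∑ i with key i < key j, β i with hF
  have F0 : ∀ j, 0 ≤ F j := fun j => Finset.sum_nonneg fun i _ => hβ i
  have F1 : ∀ j, F j ≤ 1 := fun j =>
    (Finset.sum_le_sum_of_subset_of_nonneg (Finset.subset_univ _) fun i _ _ => hβ i).trans hβ1
  have Fmono : ∀ i j, key i ≤ key j → F i ≤ F j := fun i j h =>
    Finset.sum_le_sum_of_subset_of_nonneg
      (fun a ha => by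
        simp only [Finset.mem_filter, Finset.mem_univ, true_and] at ha ⊢
        exact ha.trans_le h) fun i _ _ => hβ i
  have hlt : ∀ j, ⌊k * F j⌋₊ < k + 1 := fun j => by
    rw [Nat.floor_lt (by have := F0 j; positivity)]
    push_cast
    nlinarith [F1 j]
  refine ⟨Finset.univ.filter fun j => 1 / (k : ℝ) ≤ β j, fun j => ⟨⌊k * F j⌋₊, hlt j⟩, ?_, ?_, ?_⟩
  · have h1 : ((Finset.univ.filter fun j => 1 / (k : ℝ) ≤ β j).card : ℝ) * (1 / k) ≤ 1 := by
      rw [← nsmul_eq_mul]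
      refine (Finset.card_nsmul_le_sum _ β _ fun j hj => (Finset.mem_filter.1 hj).2).trans ?_
      exact (Finset.sum_le_sum_of_subset_of_nonneg (Finset.subset_univ _)
        fun i _ _ => hβ i).trans hβ1
    rw [mul_one_div, div_le_one hk'] at h1
    exact_mod_cast h1
  · intro i j h
    by_contra! hy
    have h2 : key j ≤ key i := by
      rw [hkey, Prod.Lex.toLex_le_toLex]
      exact Or.inl hy
    have h3 : ⌊k * F j⌋₊ ≤ ⌊k * F i⌋₊ :=
      Nat.floor_mono (mul_le_mul_of_nonneg_left (Fmono _ _ h2) hk'.le)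
    exact absurd (Fin.lt_def.1 h) (not_lt.2 h3)
  · intro g
    set S := Finset.univ.filter fun j => j ∉ Finset.univ.filter (fun j => 1 / (k : ℝ) ≤ β j) ∧
      (⟨⌊k * F j⌋₊, hlt j⟩ : Fin (k + 1)) = g with hS
    have hmem : ∀ j ∈ S, β j < 1 / k ∧ ⌊k * F j⌋₊ = g := fun j hj => by
      simp only [hS, Finset.mem_filter, Finset.mem_univ, true_and, not_le] at hj
      exact ⟨hj.1, congrArg Fin.val hj.2⟩
    rcases S.eq_empty_or_nonempty with h0 | h0
    · rw [h0, Finset.sum_empty]; positivity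
    obtain ⟨a, ha, hamin⟩ := S.exists_min_image key h0
    obtain ⟨b, hb, hbmax⟩ := S.exists_max_image key h0
    have hga : (g : ℝ) ≤ k * F a := by
      rw [← (hmem a ha).2]; exact Nat.floor_le (by have := F0 a; positivity)
    have hgb : k * F b < g + 1 := by
      rw [← (hmem b hb).2]; exact Nat.lt_floor_add_one _
    have h1 : ∑ j ∈ S.erase b, β j ≤ F b - F a := by
      rw [le_sub_iff_add_le, ← Finset.sum_union]
      · refine Finset.sum_le_sum_of_subset_of_nonneg (fun j hj => ?_) fun i _ _ => hβ i
        simp only [Finset.mem_union, Finset.mem_erase, Finset.mem_filter, Finset.mem_univ,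
          true_and] at hj ⊢
        rcases hj with hj | hj
        · exact (hbmax j hj.2).lt_of_ne fun h => hj.1 (key_inj h)
        · exact hj.trans_le (hbmax a ha)
      · rw [Finset.disjoint_left]
        intro j hj hj'
        exact absurd (Finset.mem_filter.1 hj').2 (not_lt.2 (hamin j (Finset.mem_of_mem_erase hj)))
    rw [← Finset.sum_erase_add _ _ hb]
    have h2 : F b - F a ≤ 1 / k := by
      rw [le_div_iff₀ hk']; nlinarith
    have h3 := (hmem b hb).1
    calc _ ≤ 1 / (k : ℝ) + 1 / k := by linarith
      _ = 2 / k := by ring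

/-- Grouping of weighted points of the line such that points in long groups are sparse: an
interval of length `δ` carries mass at most `4 / k` of points in groups of length at least `δ`. -/
lemma exists_sparse_grouping {n : ℕ} [NeZero n] (y β : Fin n → ℝ) (hβ : ∀ j, 0 ≤ β j)
    (hβ1 : ∑ j, β j ≤ 1) {k : ℕ} (hk : 0 < k) :
    ∃ (H : Finset (Fin n)) (G : Fin n → Fin (k + 1)) (rep : Fin (k + 1) → Fin n)
      (ℓ : Fin (k + 1) → ℝ), H.card ≤ k ∧ (∀ j, |y j - y (rep (G j))| ≤ ℓ (G j)) ∧
      ∀ t δ : ℝ, 0 < δ →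
        ∑ j with j ∉ H ∧ δ ≤ ℓ (G j) ∧ t ≤ y j ∧ y j < t + δ, β j ≤ 4 / k := by
  obtain ⟨H, G, hH, hG, hmass⟩ := exists_monotone_grouping y β hβ hβ1 hk
  have hlo : ∀ g, ∃ a, ∀ j, G j = g → G a = g ∧ y a ≤ y j := fun g => by
    by_cases h : (Finset.univ.filter fun j => G j = g).Nonempty
    · obtain ⟨a, ha, hmin⟩ := Finset.exists_min_image _ y h
      exact ⟨a, fun j hj => ⟨(Finset.mem_filter.1 ha).2, hmin j (by simp [hj])⟩⟩
    · exact ⟨0, fun j hj => (h ⟨j, by simp [hj]⟩).elim⟩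
  have hhi : ∀ g, ∃ a, ∀ j, G j = g → G a = g ∧ y j ≤ y a := fun g => by
    by_cases h : (Finset.univ.filter fun j => G j = g).Nonempty
    · obtain ⟨a, ha, hmin⟩ := Finset.exists_max_image _ y h
      exact ⟨a, fun j hj => ⟨(Finset.mem_filter.1 ha).2, hmin j (by simp [hj])⟩⟩
    · exact ⟨0, fun j hj => (h ⟨j, by simp [hj]⟩).elim⟩
  choose lo hlo using hlo
  choose hi hhi using hhi
  refine ⟨H, G, lo, fun g => y (hi g) - y (lo g), hH, fun j => ?_, fun t δ hδ => ?_⟩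
  · have h1 := (hlo _ j rfl).2
    have h2 := (hhi _ j rfl).2
    rw [abs_of_nonneg (by linarith)]
    linarith
  set S := Finset.univ.filter fun j => j ∉ H ∧ δ ≤ y (hi (G j)) - y (lo (G j)) ∧
    t ≤ y j ∧ y j < t + δ with hS
  have hSm : ∀ j ∈ S, j ∉ H ∧ δ ≤ y (hi (G j)) - y (lo (G j)) ∧ t ≤ y j ∧ y j < t + δ :=
    fun j hj => (Finset.mem_filter.1 hj).2
  have hno : ∀ a ∈ S, ∀ b ∈ S, ∀ c ∈ S, G a < G b → G b < G c → False := by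
    intro a ha b hb c hc hab hbc
    have h1 := hG a (lo (G b)) (by rw [(hlo _ b rfl).1]; exact hab)
    have h2 := hG (hi (G b)) c (by rw [(hhi _ b rfl).1]; exact hbc)
    have h3 := hSm a ha
    have h4 := hSm b hb
    have h5 := hSm c hc
    linarith [h3.2.2.1, h4.2.1, h5.2.2.2]
  have hcard : (S.image G).card ≤ 2 := by
    by_contra! h
    obtain ⟨a, ha, b, hb, c, hc, hab, hac, hbc⟩ := Finset.two_lt_card.1 h
    obtain ⟨a, haS, rfl⟩ := Finset.mem_image.1 ha
    obtain ⟨b, hbS, rfl⟩ := Finset.mem_image.1 hb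
    obtain ⟨c, hcS, rfl⟩ := Finset.mem_image.1 hc
    have := hno a haS b hbS c hcS
    have := hno a haS c hcS b hbS
    have := hno b hbS a haS c hcS
    have := hno b hbS c hcS a haS
    have := hno c hcS a haS b hbS
    have := hno c hcS b hbS a haS
    grind
  rw [← Finset.sum_fiberwise_of_maps_to (s := S) (t := S.image G) (g := G)
    fun j hj => Finset.mem_image_of_mem G hj]
  have hk' : (0 : ℝ) < k := by exact_mod_cast hk
  calc _ ≤ ∑ g ∈ S.image G, (2 / k : ℝ) := Finset.sum_le_sum fun g _ =>
        (Finset.sum_le_sum_of_subset_of_nonneg (fun j hj => by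
          simp only [Finset.mem_filter, Finset.mem_univ, true_and] at hj ⊢
          exact ⟨(hSm j hj.1).1, hj.2⟩) fun i _ _ => hβ i).trans (hmass g)
    _ = (S.image G).card * (2 / k : ℝ) := by simp
    _ ≤ 2 * (2 / k : ℝ) := by gcongr; exact_mod_cast hcard
    _ = 4 / k := by ring

lemma summable_inv_one_add_int_sq : Summable fun m : ℤ => (1 + (m : ℝ) ^ 2)⁻¹ := by
  refine Summable.of_norm_bounded_eventually
    (Real.summable_one_div_int_pow.2 (one_lt_two)) ?_
  refine (Set.finite_singleton (0 : ℤ)).subset fun m hm => ?_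
  by_contra h0
  refine hm ?_
  have : (0 : ℝ) < (m : ℝ) ^ 2 := by
    have : (m : ℝ) ≠ 0 := by exact_mod_cast h0
    positivity
  change ‖(1 + (m : ℝ) ^ 2)⁻¹‖ ≤ 1 / (m : ℝ) ^ 2
  rw [Real.norm_of_nonneg (by positivity), one_div]
  exact inv_anti₀ this (by linarith)

/-- Summing a quadratically decaying quantity over a set of weighted points which puts mass at
most `c` on each interval of length `δ`. -/
lemma sum_mul_le_of_sparse {ι : Type*} (s : Finset ι) (y β e : ι → ℝ) (x δ c Q : ℝ)
    (hδ : 0 < δ) (hβ : ∀ j, 0 ≤ β j) (hQ : 0 ≤ Q)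
    (hc : ∀ t : ℝ, ∑ j ∈ s with t ≤ y j ∧ y j < t + δ, β j ≤ c)
    (he : ∀ j ∈ s, ∀ m : ℤ, |(m : ℝ)| ≤ |x - y j| / δ + 1 → e j * (1 + (m : ℝ) ^ 2) ≤ Q) :
    ∑ j ∈ s, β j * e j ≤ c * Q * ∑' m : ℤ, (1 + (m : ℝ) ^ 2)⁻¹ := by
  classical
  have hc0 : 0 ≤ c := (Finset.sum_nonneg fun i _ => hβ i).trans (hc 0)
  set M : ι → ℤ := fun j => ⌊(y j - x) / δ⌋ with hM
  have hcell : ∀ j, x + M j * δ ≤ y j ∧ y j < x + M j * δ + δ := fun j => by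
    have h1 := Int.floor_le ((y j - x) / δ)
    have h2 := Int.lt_floor_add_one ((y j - x) / δ)
    rw [le_div_iff₀ hδ] at h1
    rw [div_lt_iff₀ hδ] at h2
    simp only [hM]
    constructor <;> linarith
  have hMle : ∀ j, |(M j : ℝ)| ≤ |x - y j| / δ + 1 := fun j => by
    have h1 := Int.floor_le ((y j - x) / δ)
    have h2 := Int.lt_floor_add_one ((y j - x) / δ)
    have h3 : |x - y j| / δ = |(y j - x) / δ| := by
      rw [abs_div, abs_of_pos hδ, abs_sub_comm]
    have h4 := neg_abs_le ((y j - x) / δ)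
    have h5 := le_abs_self ((y j - x) / δ)
    rw [h3, abs_le]
    simp only [hM]
    constructor <;> linarith
  rw [← Finset.sum_fiberwise_of_maps_to (s := s) (t := s.image M) (g := M)
    fun j hj => Finset.mem_image_of_mem M hj, ← tsum_mul_left]
  refine le_trans (Finset.sum_le_sum (g := fun m : ℤ => c * Q * (1 + (m : ℝ) ^ 2)⁻¹)
    fun m _ => ?_) ((summable_inv_one_add_int_sq.mul_left _).sum_le_tsum _
      fun m _ => by positivity)
  calc ∑ j ∈ s with M j = m, β j * e j
      ≤ ∑ j ∈ s with M j = m, β j * (Q * (1 + (m : ℝ) ^ 2)⁻¹) := by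
        refine Finset.sum_le_sum fun j hj => mul_le_mul_of_nonneg_left ?_ (hβ j)
        obtain ⟨hjs, rfl⟩ := Finset.mem_filter.1 hj
        rw [← div_eq_mul_inv, le_div_iff₀ (by positivity)]
        exact he j hjs _ (hMle j)
    _ = (∑ j ∈ s with M j = m, β j) * (Q * (1 + (m : ℝ) ^ 2)⁻¹) := by rw [Finset.sum_mul]
    _ ≤ c * (Q * (1 + (m : ℝ) ^ 2)⁻¹) := by
        refine mul_le_mul_of_nonneg_right (le_trans ?_ (hc (x + m * δ))) (by positivity)
        refine Finset.sum_le_sum_of_subset_of_nonneg (fun j hj => ?_) fun i _ _ => hβ i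
        obtain ⟨hjs, rfl⟩ := Finset.mem_filter.1 hj
        exact Finset.mem_filter.2 ⟨hjs, hcell j⟩
    _ = _ := by ring

/-- Variation of a divided difference in one variable. -/
lemma normSq_dividedDifference_sub_le {p p' q : ℂ} {x x' y L δ : ℝ} (hL : 0 ≤ L) (hδ : 0 < δ)
    (h : ‖p - q‖ ≤ L * |x - y|) (h' : ‖p' - q‖ ≤ L * |x' - y|) (hp : ‖p - p'‖ ≤ L * |x - x'|)
    (hx : |x - x'| ≤ δ) {m : ℤ} (hm : |(m : ℝ)| ≤ |x - y| / δ + 1) :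
    ‖(p - q) / (x - y : ℝ) - (p' - q) / (x' - y : ℝ)‖ ^ 2 * (1 + (m : ℝ) ^ 2) ≤ 20 * L ^ 2 := by
  have hD : ‖(p - q) / (x - y : ℝ)‖ ≤ L := by
    rw [norm_div, Complex.norm_real, Real.norm_eq_abs]
    exact div_le_of_le_mul₀ (abs_nonneg _) hL h
  have hD' : ‖(p' - q) / (x' - y : ℝ)‖ ≤ L := by
    rw [norm_div, Complex.norm_real, Real.norm_eq_abs]
    exact div_le_of_le_mul₀ (abs_nonneg _) hL h'
  set E := (p - q) / (x - y : ℝ) - (p' - q) / (x' - y : ℝ) with hE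
  have h1 : ‖E‖ ≤ 2 * L := (norm_sub_le _ _).trans (by linarith)
  have h2 : ‖E‖ * |x - y| ≤ 2 * L * δ := by
    rcases eq_or_ne x y with rfl | hxy
    · simp; positivity
    have hxy' : ((x - y : ℝ) : ℂ) ≠ 0 := by exact_mod_cast sub_ne_zero.2 hxy
    have h3 : E * (x - y : ℝ) = (p - p') - (p' - q) / (x' - y : ℝ) * (x - x' : ℝ) := by
      rcases eq_or_ne x' y with rfl | hxy2
      · have : p' = q := by simpa [sub_eq_zero] using h'
        subst this
        rw [hE, sub_self, zero_div, sub_zero, zero_mul, sub_zero, div_mul_cancel₀ _ hxy']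
      · have hxy2' : ((x' - y : ℝ) : ℂ) ≠ 0 := by exact_mod_cast sub_ne_zero.2 hxy2
        rw [hE]
        field_simp
        push_cast
        ring
    calc ‖E‖ * |x - y| = ‖E * (x - y : ℝ)‖ := by
          rw [norm_mul, Complex.norm_real, Real.norm_eq_abs]
      _ ≤ ‖p - p'‖ + ‖(p' - q) / (x' - y : ℝ) * (x - x' : ℝ)‖ := by
          rw [h3]; exact norm_sub_le _ _
      _ ≤ L * |x - x'| + L * |x - x'| := by
          rw [norm_mul, Complex.norm_real, Real.norm_eq_abs]
          gcongr
      _ ≤ L * δ + L * δ := by gcongr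
      _ = _ := by ring
  set r := |x - y| / δ with hr
  have hr0 : 0 ≤ r := by positivity
  have h4 : ‖E‖ * r ≤ 2 * L := by
    rw [hr, ← mul_div_assoc, div_le_iff₀ hδ]; exact h2
  have h5 : (m : ℝ) ^ 2 ≤ (r + 1) ^ 2 := by
    rw [← sq_abs]; gcongr
  have h6 : ‖E‖ ^ 2 ≤ 4 * L ^ 2 := by nlinarith [norm_nonneg E]
  have h7 : ‖E‖ ^ 2 * r ^ 2 ≤ 4 * L ^ 2 := by
    have : 0 ≤ ‖E‖ * r := by positivity
    nlinarith
  have h8 : ‖E‖ ^ 2 * r ≤ 4 * L ^ 2 := by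
    have : 0 ≤ ‖E‖ ^ 2 * (r - 1) ^ 2 := by positivity
    nlinarith
  calc ‖E‖ ^ 2 * (1 + (m : ℝ) ^ 2) ≤ ‖E‖ ^ 2 * (1 + (r + 1) ^ 2) := by gcongr
    _ ≤ 20 * L ^ 2 := by nlinarith

lemma sum_normSq_dividedDifference_sub_le {ι : Type*} (s : Finset ι) (y β : ι → ℝ) (q : ι → ℂ)
    {p p' : ℂ} {x x' L δ c : ℝ} (hL : 0 ≤ L) (hδ : 0 ≤ δ) (hc0 : 0 ≤ c) (hβ : ∀ j, 0 ≤ β j)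
    (hc : 0 < δ → ∀ t : ℝ, ∑ j ∈ s with t ≤ y j ∧ y j < t + δ, β j ≤ c)
    (h : ∀ j, ‖p - q j‖ ≤ L * |x - y j|) (h' : ∀ j, ‖p' - q j‖ ≤ L * |x' - y j|)
    (hp : ‖p - p'‖ ≤ L * |x - x'|) (hx : |x - x'| ≤ δ) :
    ∑ j ∈ s, β j * ‖(p - q j) / (x - y j : ℝ) - (p' - q j) / (x' - y j : ℝ)‖ ^ 2 ≤
      c * (20 * L ^ 2) * ∑' m : ℤ, (1 + (m : ℝ) ^ 2)⁻¹ := by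
  rcases hδ.eq_or_lt with rfl | hδ
  · have hxx : x = x' := by
      simpa [sub_eq_zero] using le_antisymm hx (abs_nonneg _)
    subst hxx
    have hpp : p = p' := by simpa [sub_eq_zero] using hp
    subst hpp
    have : 0 ≤ ∑' m : ℤ, (1 + (m : ℝ) ^ 2)⁻¹ := tsum_nonneg fun m => by positivity
    simp only [sub_self, norm_zero]
    simp
    positivity
  · exact sum_mul_le_of_sparse s y β _ x δ c _ hδ hβ (by positivity) (hc hδ)
      fun j _ m hm => normSq_dividedDifference_sub_le hL hδ (h j) (h' j) hp hx hm

lemma Matrix.rank_add_le_of_field {m n : ℕ} (A B : Matrix (Fin m) (Fin n) ℂ) :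
    (A + B).rank ≤ A.rank + B.rank := by
  unfold Matrix.rank
  rw [Matrix.mulVecLin_add]
  exact (Submodule.finrank_mono (LinearMap.range_add_le _ _)).trans
    (Submodule.finrank_add_le_finrank_add_finrank _ _)

lemma Matrix.rank_sub_le_of_field {m n : ℕ} (A B : Matrix (Fin m) (Fin n) ℂ) :
    (A - B).rank ≤ A.rank + B.rank := by
  have h : (-B).rank = B.rank := by
    unfold Matrix.rank
    rw [show (-B).mulVecLin = -B.mulVecLin by ext; simp, LinearMap.range_neg]
  rw [sub_eq_add_neg, ← h]
  exact Matrix.rank_add_le_of_field _ _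

/-- Trace duality against a matrix of rank at most `r`. -/
lemma norm_sum_mul_le_of_rank_le {n r : ℕ} (R T : Matrix (Fin n) (Fin n) ℂ) (hR : R.rank ≤ r)
    {M : ℝ} (hM : 0 ≤ M)
    (hT : ∀ e : EuclideanSpace ℂ (Fin n), ∑ j, ‖∑ i, e i * T i j‖ ^ 2 ≤ M ^ 2 * ‖e‖ ^ 2) :
    ‖∑ i, ∑ j, R i j * T i j‖ ≤ M * √(r * ∑ i, ∑ j, ‖R i j‖ ^ 2) := by
  set W := LinearMap.range (Matrix.toEuclideanLin R) with hW
  have hrank : Module.finrank ℂ W ≤ r := by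
    refine le_trans (le_of_eq ?_) hR
    rw [R.rank_eq_finrank_range_toLin (EuclideanSpace.basisFun (Fin n) ℂ).toBasis
      (EuclideanSpace.basisFun (Fin n) ℂ).toBasis, ← Matrix.toEuclideanLin_eq_toLin_orthonormal]
  set b := stdOrthonormalBasis ℂ W
  set c : Fin n → W := fun j =>
    ⟨Matrix.toEuclideanLin R (EuclideanSpace.single j 1), LinearMap.mem_range_self _ _⟩ with hc
  have hcv : ∀ i j, (c j : EuclideanSpace ℂ (Fin n)) i = R i j := fun i j => by
    simp [hc, Matrix.toLpLin_apply]
  have hexp : ∀ i j, R i j = ∑ s, inner ℂ (b s) (c j) * (b s : EuclideanSpace ℂ (Fin n)) i := by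
    intro i j
    have h := congrArg (fun w : W => (w : EuclideanSpace ℂ (Fin n)) i) (b.sum_repr' (c j))
    simp only [hcv] at h
    rw [← h]
    simp
  have hcn : ∀ j, ‖c j‖ ^ 2 = ∑ i, ‖R i j‖ ^ 2 := fun j => by
    rw [Submodule.coe_norm, EuclideanSpace.norm_sq_eq]
    simp only [hcv]
  have hkey : ∑ i, ∑ j, R i j * T i j = ∑ z : Fin (Module.finrank ℂ W) × Fin n,
      inner ℂ (b z.1) (c z.2) * ∑ i, (b z.1 : EuclideanSpace ℂ (Fin n)) i * T i z.2 := by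
    rw [Fintype.sum_prod_type_right, Finset.sum_comm]
    refine Finset.sum_congr rfl fun j _ => ?_
    simp only [Finset.mul_sum]
    rw [Finset.sum_comm]
    refine Finset.sum_congr rfl fun i _ => ?_
    rw [hexp i j, Finset.sum_mul]
    exact Finset.sum_congr rfl fun s _ => by ring
  rw [hkey]
  calc _ ≤ ∑ z : Fin (Module.finrank ℂ W) × Fin n, ‖inner ℂ (b z.1) (c z.2)‖ *
        ‖∑ i, (b z.1 : EuclideanSpace ℂ (Fin n)) i * T i z.2‖ :=
        (norm_sum_le _ _).trans (by simp only [norm_mul]; exact le_rfl)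
    _ ≤ √(∑ z : Fin (Module.finrank ℂ W) × Fin n, ‖inner ℂ (b z.1) (c z.2)‖ ^ 2) *
        √(∑ z : Fin (Module.finrank ℂ W) × Fin n,
          ‖∑ i, (b z.1 : EuclideanSpace ℂ (Fin n)) i * T i z.2‖ ^ 2) :=
        Real.sum_mul_le_sqrt_mul_sqrt _ _ _
    _ ≤ √(∑ i, ∑ j, ‖R i j‖ ^ 2) * √(r * M ^ 2) := by
        gcongr
        · rw [Fintype.sum_prod_type_right, Finset.sum_comm (f := fun i j => ‖R i j‖ ^ 2)]
          refine le_of_eq (Finset.sum_congr rfl fun j _ => ?_)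
          rw [← hcn]
          exact b.sum_sq_norm_inner_right (c j)
        · rw [Fintype.sum_prod_type]
          calc _ ≤ ∑ s : Fin (Module.finrank ℂ W), M ^ 2 := by
                refine Finset.sum_le_sum fun s _ => (hT (b s)).trans ?_
                rw [← Submodule.coe_norm, b.norm_eq_one]; simp
            _ = (Module.finrank ℂ W : ℝ) * M ^ 2 := by simp
            _ ≤ _ := by gcongr
    _ = _ := by
        rw [Real.sqrt_mul (by positivity), Real.sqrt_mul (by positivity), Real.sqrt_sq hM]
        ring

/-- Nazarov-Peller: a divided difference matrix of a Lipschitz function, multiplied entrywise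
by a rank one matrix, is within `O(k ^ (-1 / 2))` of a matrix of rank `O(k)` in the
Hilbert-Schmidt norm. -/
lemma exists_rank_le_approx {n : ℕ} [NeZero n] (x y : Fin n → ℝ) (p q : Fin n → ℂ) {L : ℝ}
    (hL : 0 ≤ L) (hpq : ∀ i j, ‖p i - q j‖ ≤ L * |x i - y j|)
    (hpp : ∀ i j, ‖p i - p j‖ ≤ L * |x i - x j|) (hqq : ∀ i j, ‖q i - q j‖ ≤ L * |y i - y j|)
    (u v : Fin n → ℂ) (hu : ∑ i, ‖u i‖ ^ 2 ≤ 1) (hv : ∑ j, ‖v j‖ ^ 2 ≤ 1) {k : ℕ} (hk : 0 < k) :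
    ∃ R : Matrix (Fin n) (Fin n) ℂ, R.rank ≤ 6 * k ∧
      ∑ i, ∑ j, ‖u i * v j * ((p i - q j) / (x i - y j : ℝ)) - R i j‖ ^ 2 ≤
        160 * (∑' m : ℤ, (1 + (m : ℝ) ^ 2)⁻¹) * L ^ 2 / k := by
  classical
  obtain ⟨H, G, rep, ℓ, hH, hrep, hsp⟩ :=
    exists_sparse_grouping x (fun i => ‖u i‖ ^ 2) (fun i => by positivity) hu hk
  obtain ⟨H', G', rep', ℓ', hH', hrep', hsp'⟩ :=
    exists_sparse_grouping y (fun i => ‖v i‖ ^ 2) (fun i => by positivity) hv hk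
  set D : Fin n → Fin n → ℂ := fun i j => (p i - q j) / (x i - y j : ℝ) with hD
  have hDs : ∀ i j, D i j = (q j - p i) / (y j - x i : ℝ) := fun i j => by
    rw [← neg_sub (p i), ← neg_sub (x i), Complex.ofReal_neg, neg_div_neg_eq]
  set S := ∑' m : ℤ, (1 + (m : ℝ) ^ 2)⁻¹ with hS
  set K : Matrix (Fin n) (Fin n) ℂ := Matrix.of fun i j => u i * v j * D i j with hK
  set R₁ := Matrix.diagonal (fun i => if i ∈ H then (1 : ℂ) else 0) * K with hR₁
  set R₂ := (Matrix.diagonal (fun i => if i ∈ H then (0 : ℂ) else 1) * K) *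
    Matrix.diagonal (fun j => if j ∈ H' then (1 : ℂ) else 0) with hR₂
  set R₃ := (Matrix.of fun i (g : Fin (k + 1)) => if i ∉ H ∧ G i = g then u i else 0) *
    (Matrix.of fun g j => if j ∉ H' ∧ ℓ g ≤ ℓ' (G' j) then v j * D (rep g) j else 0) with hR₃
  set R₄ := (Matrix.of fun i (g : Fin (k + 1)) =>
      if i ∉ H ∧ ℓ' g < ℓ (G i) then u i * D i (rep' g) else 0) *
    (Matrix.of fun g j => if j ∉ H' ∧ G' j = g then v j else 0) with hR₄
  have hdiag : ∀ s : Finset (Fin n), s.card ≤ k →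
      (Matrix.diagonal (fun i => if i ∈ s then (1 : ℂ) else 0)).rank ≤ k := fun s hs => by
    rw [Matrix.rank_diagonal]
    simpa using hs
  refine ⟨R₁ + R₂ + R₃ + R₄, ?_, ?_⟩
  · have h1 : R₁.rank ≤ k := (Matrix.rank_mul_le_left _ _).trans (hdiag H hH)
    have h2 : R₂.rank ≤ k := (Matrix.rank_mul_le_right _ _).trans (hdiag H' hH')
    have h3 : R₃.rank ≤ k + 1 := (Matrix.rank_mul_le_left _ _).trans (Matrix.rank_le_width _)
    have h4 : R₄.rank ≤ k + 1 := (Matrix.rank_mul_le_left _ _).trans (Matrix.rank_le_width _)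
    have h5 := Matrix.rank_add_le_of_field (R₁ + R₂ + R₃) R₄
    have h6 := Matrix.rank_add_le_of_field (R₁ + R₂) R₃
    have h7 := Matrix.rank_add_le_of_field R₁ R₂
    omega
  have hent : ∀ i j, u i * v j * D i j - (R₁ + R₂ + R₃ + R₄) i j =
      if i ∈ H ∨ j ∈ H' then 0 else
        if ℓ (G i) ≤ ℓ' (G' j) then u i * v j * (D i j - D (rep (G i)) j)
        else u i * v j * (D i j - D i (rep' (G' j))) := by
    intro i j
    have e1 : R₁ i j = if i ∈ H then u i * v j * D i j else 0 := by
      simp [hR₁, hK, Matrix.diagonal_mul]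
    have e2 : R₂ i j = if i ∉ H ∧ j ∈ H' then u i * v j * D i j else 0 := by
      by_cases h1 : i ∈ H <;> by_cases h2 : j ∈ H' <;>
        simp [hR₂, hK, Matrix.diagonal_mul, Matrix.mul_diagonal, h1, h2]
    have e3 : R₃ i j = if i ∉ H ∧ j ∉ H' ∧ ℓ (G i) ≤ ℓ' (G' j) then
        u i * v j * D (rep (G i)) j else 0 := by
      rw [hR₃, Matrix.mul_apply, Finset.sum_eq_single (G i)]
      · by_cases h1 : i ∈ H <;> by_cases h2 : j ∈ H' <;> simp [h1, h2, mul_assoc]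
      · intro g _ hg
        simp [hg.symm]
      · simp
    have e4 : R₄ i j = if i ∉ H ∧ j ∉ H' ∧ ℓ' (G' j) < ℓ (G i) then
        u i * v j * D i (rep' (G' j)) else 0 := by
      rw [hR₄, Matrix.mul_apply, Finset.sum_eq_single (G' j)]
      · by_cases h1 : i ∈ H <;> by_cases h2 : j ∈ H' <;> simp [h1, h2, mul_right_comm]
      · intro g _ hg
        simp [hg.symm]
      · simp
    rw [Matrix.add_apply, Matrix.add_apply, Matrix.add_apply, e1, e2, e3, e4]
    by_cases h1 : i ∈ H <;> by_cases h2 : j ∈ H' <;> by_cases h3 : ℓ (G i) ≤ ℓ' (G' j) <;>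
      simp [h1, h2, h3, mul_sub, not_lt.2, not_le.1]
  have hle : ∀ i j, ‖u i * v j * D i j - (R₁ + R₂ + R₃ + R₄) i j‖ ^ 2 ≤
      (if j ∉ H' ∧ ℓ (G i) ≤ ℓ' (G' j) then
        ‖u i‖ ^ 2 * (‖v j‖ ^ 2 * ‖D i j - D (rep (G i)) j‖ ^ 2) else 0) +
      (if i ∉ H ∧ ℓ' (G' j) ≤ ℓ (G i) then
        ‖v j‖ ^ 2 * (‖u i‖ ^ 2 * ‖D i j - D i (rep' (G' j))‖ ^ 2) else 0) := by
    intro i j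
    have n1 : 0 ≤ ‖u i‖ ^ 2 * (‖v j‖ ^ 2 * ‖D i j - D (rep (G i)) j‖ ^ 2) := by positivity
    have n2 : 0 ≤ ‖v j‖ ^ 2 * (‖u i‖ ^ 2 * ‖D i j - D i (rep' (G' j))‖ ^ 2) := by positivity
    have e1 : ‖u i * v j * (D i j - D (rep (G i)) j)‖ ^ 2 =
        ‖u i‖ ^ 2 * (‖v j‖ ^ 2 * ‖D i j - D (rep (G i)) j‖ ^ 2) := by
      rw [norm_mul, norm_mul]; ring
    have e2 : ‖u i * v j * (D i j - D i (rep' (G' j)))‖ ^ 2 =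
        ‖v j‖ ^ 2 * (‖u i‖ ^ 2 * ‖D i j - D i (rep' (G' j))‖ ^ 2) := by
      rw [norm_mul, norm_mul]; ring
    rw [hent]
    by_cases h1 : i ∈ H
    · rw [if_pos (Or.inl h1), norm_zero]
      split_ifs <;> simp <;> positivity
    by_cases h2 : j ∈ H'
    · rw [if_pos (Or.inr h2), norm_zero]
      split_ifs <;> simp <;> positivity
    rw [if_neg (by tauto)]
    by_cases h3 : ℓ (G i) ≤ ℓ' (G' j)
    · rw [if_pos h3, if_pos ⟨h2, h3⟩, e1]
      split_ifs <;> linarith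
    · rw [if_neg h3, if_neg (by tauto), if_pos ⟨h1, (not_le.1 h3).le⟩, e2, zero_add]
  have hk0 : (0 : ℝ) ≤ 4 / k := by positivity
  have hS0 : 0 ≤ S := tsum_nonneg fun m => by positivity
  have hA : ∀ i, ∑ j with j ∉ H' ∧ ℓ (G i) ≤ ℓ' (G' j),
      ‖v j‖ ^ 2 * ‖D i j - D (rep (G i)) j‖ ^ 2 ≤ 4 / k * (20 * L ^ 2) * S := fun i => by
    refine sum_normSq_dividedDifference_sub_le _ y (fun j => ‖v j‖ ^ 2) q hL
      ((abs_nonneg _).trans (hrep i)) hk0 (fun j => by positivity) (fun hδ t => ?_)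
      (fun j => hpq i j) (fun j => hpq _ j) (hpp _ _) (hrep i)
    refine le_trans (le_of_eq ?_) (hsp' t _ hδ)
    rw [Finset.filter_filter]
    simp only [and_assoc]
  have hB : ∀ j, ∑ i with i ∉ H ∧ ℓ' (G' j) ≤ ℓ (G i),
      ‖u i‖ ^ 2 * ‖D i j - D i (rep' (G' j))‖ ^ 2 ≤ 4 / k * (20 * L ^ 2) * S := fun j => by
    simp only [hDs]
    have hqp : ∀ j i, ‖q j - p i‖ ≤ L * |y j - x i| := fun j i => by
      rw [norm_sub_rev, abs_sub_comm]; exact hpq i j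
    refine sum_normSq_dividedDifference_sub_le _ x (fun j => ‖u j‖ ^ 2) p hL
      ((abs_nonneg _).trans (hrep' j)) hk0 (fun j => by positivity) (fun hδ t => ?_)
      (fun i => hqp j i) (fun i => hqp _ i) (hqq _ _) (hrep' j)
    refine le_trans (le_of_eq ?_) (hsp t _ hδ)
    rw [Finset.filter_filter]
    simp only [and_assoc]
  set B := 4 / k * (20 * L ^ 2) * S with hBdef
  have hB0 : 0 ≤ B := by positivity
  calc _ ≤ ∑ i, ∑ j, ((if j ∉ H' ∧ ℓ (G i) ≤ ℓ' (G' j) then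
        ‖u i‖ ^ 2 * (‖v j‖ ^ 2 * ‖D i j - D (rep (G i)) j‖ ^ 2) else 0) +
      (if i ∉ H ∧ ℓ' (G' j) ≤ ℓ (G i) then
        ‖v j‖ ^ 2 * (‖u i‖ ^ 2 * ‖D i j - D i (rep' (G' j))‖ ^ 2) else 0)) :=
        Finset.sum_le_sum fun i _ => Finset.sum_le_sum fun j _ => hle i j
    _ = (∑ i, ‖u i‖ ^ 2 * ∑ j with j ∉ H' ∧ ℓ (G i) ≤ ℓ' (G' j),
          ‖v j‖ ^ 2 * ‖D i j - D (rep (G i)) j‖ ^ 2) +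
        ∑ j, ‖v j‖ ^ 2 * ∑ i with i ∉ H ∧ ℓ' (G' j) ≤ ℓ (G i),
          ‖u i‖ ^ 2 * ‖D i j - D i (rep' (G' j))‖ ^ 2 := by
        simp only [Finset.sum_add_distrib, Finset.mul_sum, ← Finset.sum_filter]
        congr 1
        simp only [Finset.sum_filter]
        rw [Finset.sum_comm]
    _ ≤ (∑ i, ‖u i‖ ^ 2 * B) + ∑ j, ‖v j‖ ^ 2 * B := by
        gcongr with i _ j _
        · exact hA i
        · exact hB j
    _ ≤ 1 * B + 1 * B := by
        rw [← Finset.sum_mul, ← Finset.sum_mul]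
        gcongr
    _ = _ := by rw [hBdef]; ring

lemma sum_normSq_sub_le {n : ℕ} (A B : Matrix (Fin n) (Fin n) ℂ) {a b : ℝ}
    (hA : ∑ i, ∑ j, ‖A i j‖ ^ 2 ≤ a) (hB : ∑ i, ∑ j, ‖B i j‖ ^ 2 ≤ b) :
    ∑ i, ∑ j, ‖A i j - B i j‖ ^ 2 ≤ 2 * (a + b) := by
  calc _ ≤ ∑ i, ∑ j, 2 * (‖A i j‖ ^ 2 + ‖B i j‖ ^ 2) := by
        refine Finset.sum_le_sum fun i _ => Finset.sum_le_sum fun j _ => ?_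
        refine (pow_le_pow_left₀ (norm_nonneg _) (norm_sub_le _ _) 2).trans ?_
        nlinarith [sq_nonneg (‖A i j‖ - ‖B i j‖)]
    _ = 2 * (∑ i, ∑ j, ‖A i j‖ ^ 2 + ∑ i, ∑ j, ‖B i j‖ ^ 2) := by
        simp only [← Finset.mul_sum, Finset.sum_add_distrib]
    _ ≤ _ := by gcongr

/-- Divided difference matrices of Lipschitz functions are Schur multipliers of norm
`O(1 + log n)`. -/
lemma norm_sum_dividedDifference_mul_le {n : ℕ} [NeZero n] (x y : Fin n → ℝ) (p q : Fin n → ℂ)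
    {L : ℝ} (hL : 0 ≤ L) (hpq : ∀ i j, ‖p i - q j‖ ≤ L * |x i - y j|)
    (hpp : ∀ i j, ‖p i - p j‖ ≤ L * |x i - x j|) (hqq : ∀ i j, ‖q i - q j‖ ≤ L * |y i - y j|)
    (u v : Fin n → ℂ) (hu : ∑ i, ‖u i‖ ^ 2 ≤ 1) (hv : ∑ j, ‖v j‖ ^ 2 ≤ 1)
    (T : Matrix (Fin n) (Fin n) ℂ) {M : ℝ} (hM : 0 ≤ M)
    (hT : ∀ e : EuclideanSpace ℂ (Fin n), ∑ j, ‖∑ i, e i * T i j‖ ^ 2 ≤ M ^ 2 * ‖e‖ ^ 2) :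
    ‖∑ i, ∑ j, u i * v j * ((p i - q j) / (x i - y j : ℝ)) * T i j‖ ≤
      3 * √(54 * (160 * (∑' m : ℤ, (1 + (m : ℝ) ^ 2)⁻¹) + 1)) * (1 + Real.log n) * L * M := by
  set c := 160 * (∑' m : ℤ, (1 + (m : ℝ) ^ 2)⁻¹) + 1 with hc
  have hc1 : 1 ≤ c := by
    have : 0 ≤ ∑' m : ℤ, (1 + (m : ℝ) ^ 2)⁻¹ := tsum_nonneg fun m => by positivity
    linarith
  set K : Matrix (Fin n) (Fin n) ℂ :=
    Matrix.of fun i j => u i * v j * ((p i - q j) / (x i - y j : ℝ)) with hK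
  have happ : ∀ m : ℕ, ∃ R : Matrix (Fin n) (Fin n) ℂ, R.rank ≤ 6 * 2 ^ m ∧
      ∑ i, ∑ j, ‖(K - R) i j‖ ^ 2 ≤ c * L ^ 2 / 2 ^ m := fun m => by
    obtain ⟨R, hR, hKR⟩ := exists_rank_le_approx x y p q hL hpq hpp hqq u v hu hv
      (k := 2 ^ m) (by positivity)
    refine ⟨R, hR, hKR.trans ?_⟩
    push_cast
    gcongr
    linarith
  choose R hRr hRK using happ
  set κ := M * L * √(54 * c) with hκ
  have hsqrt : ∀ t : ℝ, t ≤ 54 * c * L ^ 2 → M * √t ≤ κ := fun t ht => by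
    rw [hκ, mul_assoc, mul_comm L]
    gcongr
    refine (Real.sqrt_le_sqrt ht).trans (le_of_eq ?_)
    rw [Real.sqrt_mul (by positivity), Real.sqrt_sq hL]
  have hpair : ∀ (A : Matrix (Fin n) (Fin n) ℂ) (r : ℕ) (a : ℝ), A.rank ≤ r →
      ∑ i, ∑ j, ‖A i j‖ ^ 2 ≤ a → r * a ≤ 54 * c * L ^ 2 →
      ‖∑ i, ∑ j, A i j * T i j‖ ≤ κ := fun A r a hr ha hra =>
    (norm_sum_mul_le_of_rank_le A T hr hM hT).trans
      (hsqrt _ ((mul_le_mul_of_nonneg_left ha (Nat.cast_nonneg r)).trans hra))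
  have hKn : ∑ i, ∑ j, ‖K i j‖ ^ 2 ≤ L ^ 2 := by
    calc _ ≤ ∑ i, ∑ j, (‖u i‖ ^ 2 * ‖v j‖ ^ 2) * L ^ 2 := by
          refine Finset.sum_le_sum fun i _ => Finset.sum_le_sum fun j _ => ?_
          rw [hK, Matrix.of_apply, norm_mul, norm_mul, mul_pow, mul_pow]
          gcongr
          rw [norm_div, Complex.norm_real, Real.norm_eq_abs]
          exact div_le_of_le_mul₀ (abs_nonneg _) hL (hpq i j)
      _ = (∑ i, ‖u i‖ ^ 2) * (∑ j, ‖v j‖ ^ 2) * L ^ 2 := by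
          rw [Finset.sum_mul_sum]; simp only [Finset.sum_mul]
      _ ≤ 1 * 1 * L ^ 2 := by gcongr
      _ = L ^ 2 := by ring
  have hind : ∀ m : ℕ, ‖∑ i, ∑ j, R m i j * T i j‖ ≤ κ * (m + 1) := by
    intro m
    induction m with
    | zero =>
      have h := sum_normSq_sub_le K (K - R 0) hKn (hRK 0)
      simp only [Matrix.sub_apply, _root_.sub_sub_cancel] at h
      refine (hpair (R 0) 6 _ (by simpa using hRr 0) h ?_).trans (by simp)
      norm_num
      nlinarith [sq_nonneg L]
    | succ m ih =>
      have h := sum_normSq_sub_le (K - R m) (K - R (m + 1)) (hRK m) (hRK (m + 1))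
      simp only [Matrix.sub_apply, _root_.sub_sub_sub_cancel_left] at h
      have hstep := hpair (R (m + 1) - R m) (18 * 2 ^ m) _
        ((Matrix.rank_sub_le_of_field _ _).trans (by
          have := hRr m
          have := hRr (m + 1)
          rw [pow_succ] at this
          omega)) h (by
        push_cast
        rw [pow_succ (2 : ℝ) m]
        have : (2 : ℝ) ^ m ≠ 0 := by positivity
        have e : 18 * (2 : ℝ) ^ m * (2 * (c * L ^ 2 / 2 ^ m + c * L ^ 2 / (2 ^ m * 2))) =
            54 * c * L ^ 2 := by
          field_simp
          ring
        exact e.le)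
      have heq : ∑ i, ∑ j, R (m + 1) i j * T i j = ∑ i, ∑ j, R m i j * T i j +
          ∑ i, ∑ j, (R (m + 1) - R m) i j * T i j := by
        simp only [← Finset.sum_add_distrib, Matrix.sub_apply]
        exact Finset.sum_congr rfl fun i _ => Finset.sum_congr rfl fun j _ => by ring
      rw [heq]
      refine (norm_add_le _ _).trans ?_
      push_cast
      linarith
  set N := Nat.log 2 n + 1 with hN
  have hnN : n ≤ 2 ^ N := (Nat.lt_pow_succ_log_self one_lt_two n).le
  have hlast := hpair (K - R N) (2 ^ N) _ ((Matrix.rank_le_width _).trans hnN) (hRK N) (by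
    push_cast
    have : (2 : ℝ) ^ N ≠ 0 := by positivity
    rw [mul_div_cancel₀ _ this]
    nlinarith [sq_nonneg L])
  have heq : ∑ i, ∑ j, K i j * T i j = ∑ i, ∑ j, R N i j * T i j +
      ∑ i, ∑ j, (K - R N) i j * T i j := by
    simp only [← Finset.sum_add_distrib, Matrix.sub_apply]
    exact Finset.sum_congr rfl fun i _ => Finset.sum_congr rfl fun j _ => by ring
  have hlog : (Nat.log 2 n : ℝ) ≤ 2 * Real.log n := by
    have h1 : ((2 : ℝ) ^ Nat.log 2 n) ≤ n := by
      exact_mod_cast Nat.pow_log_le_self 2 (NeZero.ne n)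
    have h2 := Real.log_le_log (by positivity) h1
    rw [Real.log_pow] at h2
    have h3 := Real.log_two_gt_d9
    have h4 : (0 : ℝ) ≤ Nat.log 2 n := Nat.cast_nonneg _
    nlinarith
  have hlog0 : 0 ≤ Real.log n := Real.log_natCast_nonneg n
  have hκ0 : 0 ≤ κ := by positivity
  change ‖∑ i, ∑ j, K i j * T i j‖ ≤ _
  rw [heq]
  calc _ ≤ κ * (N + 1) + κ := (norm_add_le _ _).trans (add_le_add (hind N) hlast)
    _ = κ * (Nat.log 2 n + 3) := by rw [hN]; push_cast; ring
    _ ≤ κ * (3 * (1 + Real.log n)) := by gcongr; linarith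
    _ = _ := by rw [hκ]; ring

/-- The functional calculus acts on eigenvectors by evaluation at the eigenvalue. -/
lemma cfcC_apply_of_apply_eq_smul {H : Type} [NormedAddCommGroup H] [InnerProductSpace ℂ H]
    [CompleteSpace H] [FiniteDimensional ℂ H] {A : H →L[ℂ] H} (hA : IsSelfAdjoint A) (f : ℝ → ℂ)
    {v : H} {t : ℝ} (hv0 : v ≠ 0) (hv : A v = (t : ℂ) • v) : cfcC f A v = f t • v := by
  have hAn : IsStarNormal A := hA.isStarNormal
  let φ := Module.End.toContinuousLinearMap (𝕜 := ℂ) H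
  have hφ : φ (A : H →ₗ[ℂ] H) = A := rfl
  have hspec : spectrum ℂ A = spectrum ℂ (A : H →ₗ[ℂ] H) := by
    rw [← hφ, AlgEquiv.spectrum_eq φ]; rfl
  have hfin : (spectrum ℂ A).Finite := hspec ▸ Module.End.finite_spectrum (A : H →ₗ[ℂ] H)
  set P := Lagrange.interpolate hfin.toFinset id fun z : ℂ => f z.re with hP
  have heval : ∀ z ∈ spectrum ℂ A, P.eval z = f z.re := fun z hz =>
    Lagrange.eval_interpolate_at_node (v := id) (fun z : ℂ => f z.re) Function.injective_id.injOn
      (hfin.mem_toFinset.2 hz)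
  have hmem : (t : ℂ) ∈ spectrum ℂ A := by
    rw [hspec]
    exact (Module.End.hasEigenvalue_of_hasEigenvector
      (Module.End.hasEigenvector_iff.2 ⟨Module.End.mem_eigenspace_iff.2 hv, hv0⟩)).mem_spectrum
  have h1 : cfcC f A = Polynomial.aeval A P := by
    rw [← cfc_polynomial P A]
    exact cfc_congr fun z hz => (heval z hz).symm
  have h2 : Polynomial.aeval A P = φ (Polynomial.aeval (A : H →ₗ[ℂ] H) P) := by
    rw [← Polynomial.aeval_algHom_apply φ]; rfl
  rw [h1, h2]
  change Polynomial.aeval (A : H →ₗ[ℂ] H) P v = _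
  rw [Module.End.aeval_apply_of_mem_apply_eq_smul hv, heval _ hmem, Complex.ofReal_re]

lemma mem_spectrum_real_of_apply_eq_smul {H : Type} [NormedAddCommGroup H]
    [InnerProductSpace ℂ H] {A : H →L[ℂ] H} {v : H} {t : ℝ} (hv0 : v ≠ 0)
    (hv : A v = (t : ℂ) • v) : t ∈ spectrum ℝ A := by
  rw [spectrum.mem_iff]
  rintro ⟨w, hw⟩
  have h1 : (w : H →L[ℂ] H) v = 0 := by
    rw [hw, sub_apply, hv, Algebra.algebraMap_eq_smul_one]
    simp
  have h2 : ((↑w⁻¹ : H →L[ℂ] H) * (w : H →L[ℂ] H)) v = v := by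
    rw [Units.inv_mul]; rfl
  rw [mul_apply_eq_comp, h1, map_zero] at h2
  exact hv0 h2.symm

theorem stmt13 :
    ∃ C : ℝ, 0 < C ∧
      ∀ n : ℕ, 1 ≤ n →
        ∀ A B : EuclideanSpace ℂ (Fin n) →L[ℂ] EuclideanSpace ℂ (Fin n),
          IsSelfAdjoint A → IsSelfAdjoint B →
          ∀ L : ℝ, 0 ≤ L →
          ∀ f : ℝ → ℂ, Continuous f →
            (∀ x ∈ spectrum ℝ A ∪ spectrum ℝ B, ∀ y ∈ spectrum ℝ A ∪ spectrum ℝ B,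
              ‖f x - f y‖ ≤ L * |x - y|) →
            ‖cfcC f A - cfcC f B‖ ≤ C * (1 + Real.log n) * L * ‖A - B‖ := by
  set C := 3 * √(54 * (160 * (∑' m : ℤ, (1 + (m : ℝ) ^ 2)⁻¹) + 1)) with hC
  have hS0 : 0 ≤ ∑' m : ℤ, (1 + (m : ℝ) ^ 2)⁻¹ := tsum_nonneg fun m => by positivity
  refine ⟨C, by positivity, fun n hn A B hA hB L hL f _ hf => ?_⟩
  have : NeZero n := ⟨by omega⟩
  have hlog0 : 0 ≤ Real.log n := Real.log_natCast_nonneg n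
  have hAs : (A : EuclideanSpace ℂ (Fin n) →ₗ[ℂ] EuclideanSpace ℂ (Fin n)).IsSymmetric :=
    hA.isSymmetric
  have hBs : (B : EuclideanSpace ℂ (Fin n) →ₗ[ℂ] EuclideanSpace ℂ (Fin n)).IsSymmetric :=
    hB.isSymmetric
  set a := hAs.eigenvectorBasis finrank_euclideanSpace_fin
  set b := hBs.eigenvectorBasis finrank_euclideanSpace_fin
  set x := hAs.eigenvalues finrank_euclideanSpace_fin
  set y := hBs.eigenvalues finrank_euclideanSpace_fin
  have ha : ∀ i, A (a i) = (x i : ℂ) • a i :=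
    hAs.apply_eigenvectorBasis finrank_euclideanSpace_fin
  have hb : ∀ i, B (b i) = (y i : ℂ) • b i :=
    hBs.apply_eigenvectorBasis finrank_euclideanSpace_fin
  have ha0 : ∀ i, a i ≠ 0 := fun i => a.orthonormal.ne_zero i
  have hb0 : ∀ i, b i ≠ 0 := fun i => b.orthonormal.ne_zero i
  have hx : ∀ i, x i ∈ spectrum ℝ A ∪ spectrum ℝ B := fun i =>
    Or.inl (mem_spectrum_real_of_apply_eq_smul (ha0 i) (ha i))
  have hy : ∀ i, y i ∈ spectrum ℝ A ∪ spectrum ℝ B := fun i =>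
    Or.inr (mem_spectrum_real_of_apply_eq_smul (hb0 i) (hb i))
  set T : Matrix (Fin n) (Fin n) ℂ := Matrix.of fun i j => inner ℂ (a i) ((A - B) (b j)) with hT
  have hTn : ∀ e : EuclideanSpace ℂ (Fin n),
      ∑ j, ‖∑ i, e i * T i j‖ ^ 2 ≤ ‖A - B‖ ^ 2 * ‖e‖ ^ 2 := by
    intro e
    set z := ∑ i, (starRingEnd ℂ) (e i) • a i with hz
    have h1 : ∀ j, ∑ i, e i * T i j = inner ℂ ((A - B) z) (b j) := fun j => by
      have hs : inner ℂ ((A - B) z) (b j) = inner ℂ z ((A - B) (b j)) :=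
        (hA.sub hB).isSymmetric z (b j)
      rw [hs, hz, sum_inner]
      simp only [hT, Matrix.of_apply, inner_smul_left, Complex.conj_conj]
    have h2 : ‖z‖ ^ 2 = ‖e‖ ^ 2 := by
      rw [← a.sum_sq_norm_inner_right, EuclideanSpace.norm_sq_eq]
      refine Finset.sum_congr rfl fun i _ => ?_
      rw [hz, a.orthonormal.inner_right_fintype]
      simp
    simp only [h1]
    rw [b.sum_sq_norm_inner_left, ← h2, ← mul_pow]
    gcongr
    exact (A - B).le_opNorm z
  set X := cfcC f A - cfcC f B with hX
  have hfA : ∀ i w, inner ℂ (a i) (cfcC f A w) = f (x i) * inner ℂ (a i) w := fun i w => by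
    conv_lhs => rw [← a.sum_repr' w]
    simp only [map_sum, map_smul, cfcC_apply_of_apply_eq_smul hA f (ha0 _) (ha _), smul_smul]
    rw [a.orthonormal.inner_right_fintype, mul_comm]
  have hXD : ∀ i j, inner ℂ (a i) (X (b j)) =
      (f (x i) - f (y j)) / (x i - y j : ℝ) * T i j := fun i j => by
    have h1 : inner ℂ (a i) (X (b j)) = (f (x i) - f (y j)) * inner ℂ (a i) (b j) := by
      rw [hX, sub_apply, inner_sub_right, hfA,
        cfcC_apply_of_apply_eq_smul hB f (hb0 j) (hb j), inner_smul_right]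
      ring
    have h2 : T i j = (x i - y j : ℝ) * inner ℂ (a i) (b j) := by
      have hs : inner ℂ (a i) (A (b j)) = inner ℂ (A (a i)) (b j) := (hAs (a i) (b j)).symm
      rw [hT, Matrix.of_apply, sub_apply, inner_sub_right, hs, ha, hb,
        inner_smul_left, inner_smul_right, Complex.conj_ofReal]
      push_cast
      ring
    rw [h1, h2]
    rcases eq_or_ne (x i) (y j) with hxy | hxy
    · simp [hxy]
    · have : ((x i - y j : ℝ) : ℂ) ≠ 0 := by exact_mod_cast sub_ne_zero.2 hxy
      field_simp
  have hunit : ∀ w v : EuclideanSpace ℂ (Fin n), ‖w‖ = 1 → ‖v‖ = 1 →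
      ‖inner ℂ w (X v)‖ ≤ C * (1 + Real.log n) * L * ‖A - B‖ := by
    intro w v hw hv
    have h := norm_sum_dividedDifference_mul_le x y (fun i => f (x i)) (fun j => f (y j)) hL
      (fun i j => hf _ (hx i) _ (hy j)) (fun i j => hf _ (hx i) _ (hx j))
      (fun i j => hf _ (hy i) _ (hy j)) (fun i => inner ℂ w (a i)) (fun j => inner ℂ (b j) v)
      (by rw [a.sum_sq_norm_inner_left, hw]; simp) (by rw [b.sum_sq_norm_inner_right, hv]; simp)
      T (norm_nonneg (A - B)) hTn
    refine le_trans (le_of_eq ?_) h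
    congr 1
    rw [← a.sum_inner_mul_inner w]
    refine Finset.sum_congr rfl fun i _ => ?_
    conv_lhs => rw [← b.sum_repr' v]
    rw [map_sum, inner_sum, Finset.mul_sum]
    refine Finset.sum_congr rfl fun j _ => ?_
    rw [map_smul, inner_smul_right, hXD]
    ring
  refine X.opNorm_le_of_unit_norm (by positivity) fun v hv => ?_
  rcases eq_or_ne (X v) 0 with h0 | h0
  · rw [h0, norm_zero]; positivity
  have hn0 : ‖X v‖ ≠ 0 := norm_ne_zero_iff.2 h0
  have h := hunit (((‖X v‖⁻¹ : ℝ) : ℂ) • X v) v (by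
    rw [norm_smul, Complex.norm_real, Real.norm_of_nonneg (by positivity),
      inv_mul_cancel₀ hn0]) hv
  rw [inner_smul_left, norm_mul, RCLike.norm_conj, Complex.norm_real,
    Real.norm_of_nonneg (by positivity), inner_self_eq_norm_sq_to_K, norm_pow] at h
  simp only [Complex.coe_algebraMap, Complex.norm_real, norm_norm] at h
  rwa [sq, inv_mul_cancel_left₀ hn0] at h
end

section
/- There exists a constant C > 0 such that for every integer n ≥ 1, all self-adjoint n×n complex matrices A and B, every n×n complex matrix R, every L ≥ 0, and every continuous function f : ℝ → ℂ satisfying |f(x) − f(y)| ≤ L·|x − y| for all x, y in σ(A) ∪ σ(B), one has ‖f(A)·R − R·f(B)‖ ≤ C · (1 + log n) · L · ‖A·R − R·B‖. -/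
open MeasureTheory ENNReal

/-- The Euclidean norm of a finite family of complex numbers. -/
noncomputable def ellNorm {ι : Type*} [Fintype ι] (w : ι → ℂ) : ℝ := √(∑ i, ‖w i‖ ^ 2)

/-- The bilinear form of the matrix `X` is bounded by `c`, i.e. `X` has operator norm at most
`c`. -/
def FormBound {ι κ : Type*} [Fintype ι] [Fintype κ] (X : ι → κ → ℂ) (c : ℝ) : Prop :=
  ∀ (w : ι → ℂ) (v : κ → ℂ), ‖∑ i, ∑ j, w i * X i j * v j‖ ≤ c * (ellNorm w * ellNorm v)

/-- Entrywise multiplication by `m` has norm at most `c` for the operator norm of matrices. -/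
def SchurBound {ι κ : Type*} [Fintype ι] [Fintype κ] (m : ι → κ → ℂ) (c : ℝ) : Prop :=
  ∀ (X : ι → κ → ℂ) (K : ℝ), 0 ≤ K → FormBound X K → FormBound (fun i j => m i j * X i j) (c * K)

section Schur

variable {ι κ : Type*} [Fintype ι] [Fintype κ]

lemma ellNorm_nonneg (w : ι → ℂ) : 0 ≤ ellNorm w := Real.sqrt_nonneg _

lemma ellNorm_sq (w : ι → ℂ) : ellNorm w ^ 2 = ∑ i, ‖w i‖ ^ 2 :=
  Real.sq_sqrt (Finset.sum_nonneg fun _ _ => by positivity)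

lemma ellNorm_mul_le {g : ι → ℂ} {d : ℝ} (hd : 0 ≤ d) (hg : ∀ i, ‖g i‖ ≤ d) (w : ι → ℂ) :
    ellNorm (fun i => w i * g i) ≤ d * ellNorm w := by
  refine Real.sqrt_le_iff.2 ⟨mul_nonneg hd (ellNorm_nonneg w), ?_⟩
  rw [mul_pow, ellNorm_sq, Finset.mul_sum]
  refine Finset.sum_le_sum fun i _ => ?_
  rw [norm_mul, mul_pow, mul_comm]
  gcongr
  exact hg i

lemma SchurBound.congr {m m' : ι → κ → ℂ} {c : ℝ} (h : SchurBound m c)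
    (hm : ∀ i j, m' i j = m i j) : SchurBound m' c := by
  rwa [show m' = m from funext fun i => funext fun j => hm i j]

lemma SchurBound.mono {m : ι → κ → ℂ} {c d : ℝ} (h : SchurBound m c) (hcd : c ≤ d) :
    SchurBound m d := fun X K hK hX w v =>
  (h X K hK hX w v).trans <| by
    have := mul_nonneg (ellNorm_nonneg w) (ellNorm_nonneg v)
    gcongr

lemma schurBound_one : SchurBound (fun (_ : ι) (_ : κ) => (1 : ℂ)) 1 := fun X K _ hX => by
  simpa using hX

lemma SchurBound.add {m m' : ι → κ → ℂ} {c d : ℝ} (h : SchurBound m c) (h' : SchurBound m' d) :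
    SchurBound (fun i j => m i j + m' i j) (c + d) := fun X K hK hX w v => by
  have e : ∑ i, ∑ j, w i * ((m i j + m' i j) * X i j) * v j =
      ∑ i, ∑ j, w i * (m i j * X i j) * v j + ∑ i, ∑ j, w i * (m' i j * X i j) * v j := by
    simp only [← Finset.sum_add_distrib]
    exact Finset.sum_congr rfl fun i _ => Finset.sum_congr rfl fun j _ => by ring
  rw [e, add_mul, add_mul]
  exact (norm_add_le _ _).trans (add_le_add (h X K hK hX w v) (h' X K hK hX w v))

lemma SchurBound.left_mul {m : ι → κ → ℂ} {c d : ℝ} {g : ι → ℂ} (h : SchurBound m c)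
    (hc : 0 ≤ c) (hd : 0 ≤ d) (hg : ∀ i, ‖g i‖ ≤ d) :
    SchurBound (fun i j => g i * m i j) (d * c) := fun X K hK hX w v => by
  have e : ∑ i, ∑ j, w i * (g i * m i j * X i j) * v j =
      ∑ i, ∑ j, (w i * g i) * (m i j * X i j) * v j :=
    Finset.sum_congr rfl fun i _ => Finset.sum_congr rfl fun j _ => by ring
  rw [e]
  refine (h X K hK hX (fun i => w i * g i) v).trans ?_
  calc c * K * (ellNorm (fun i => w i * g i) * ellNorm v)
      ≤ c * K * (d * ellNorm w * ellNorm v) := by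
        have := ellNorm_nonneg v
        gcongr
        exact ellNorm_mul_le hd hg w
    _ = _ := by ring

lemma SchurBound.right_mul {m : ι → κ → ℂ} {c d : ℝ} {g : κ → ℂ} (h : SchurBound m c)
    (hc : 0 ≤ c) (hd : 0 ≤ d) (hg : ∀ j, ‖g j‖ ≤ d) :
    SchurBound (fun i j => g j * m i j) (d * c) := fun X K hK hX w v => by
  have e : ∑ i, ∑ j, w i * (g j * m i j * X i j) * v j =
      ∑ i, ∑ j, w i * (m i j * X i j) * (v j * g j) :=
    Finset.sum_congr rfl fun i _ => Finset.sum_congr rfl fun j _ => by ring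
  rw [e]
  refine (h X K hK hX w fun j => v j * g j).trans ?_
  calc c * K * (ellNorm w * ellNorm (fun j => v j * g j))
      ≤ c * K * (ellNorm w * (d * ellNorm v)) := by
        have := ellNorm_nonneg w
        gcongr
        exact ellNorm_mul_le hd hg v
    _ = _ := by ring

lemma schurBound_left {g : ι → ℂ} {d : ℝ} (hd : 0 ≤ d) (hg : ∀ i, ‖g i‖ ≤ d) :
    SchurBound (fun i (_ : κ) => g i) d := by
  simpa using schurBound_one.left_mul (κ := κ) zero_le_one hd hg

lemma schurBound_right {g : κ → ℂ} {d : ℝ} (hd : 0 ≤ d) (hg : ∀ j, ‖g j‖ ≤ d) :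
    SchurBound (fun (_ : ι) j => g j) d := by
  simpa using schurBound_one.right_mul (ι := ι) zero_le_one hd hg

lemma schurBound_sum {τ : Type*} (s : Finset τ) {m : τ → ι → κ → ℂ} {c : ℝ}
    (h : ∀ t ∈ s, SchurBound (m t) c) :
    SchurBound (fun i j => ∑ t ∈ s, m t i j) (s.card * c) := by
  classical
  induction s using Finset.induction_on with
  | empty => intro X K _ _ w v; simp
  | insert t s ht ih =>
    have := (h t (Finset.mem_insert_self t s)).add
      (ih fun t' ht' => h t' (Finset.mem_insert_of_mem ht'))
    simp only [Finset.sum_insert ht, Finset.card_insert_of_notMem ht]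
    refine this.mono (le_of_eq ?_)
    push_cast
    ring

lemma SchurBound.neg {m : ι → κ → ℂ} {c : ℝ} (h : SchurBound m c) :
    SchurBound (fun i j => -m i j) c := fun X K hK hX w v => by
  simpa using h X K hK hX w v

lemma ellNorm_sq_add_sq {p q : ι → ℝ} (hpq : ∀ i, p i ^ 2 + q i ^ 2 = 1) (w : ι → ℂ) :
    ellNorm (fun i => w i * p i) ^ 2 + ellNorm (fun i => w i * q i) ^ 2 = ellNorm w ^ 2 := by
  simp only [ellNorm_sq, ← Finset.sum_add_distrib]
  refine Finset.sum_congr rfl fun i _ => ?_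
  simp only [norm_mul, mul_pow, Complex.norm_real, Real.norm_eq_abs, sq_abs, ← mul_add, hpq,
    mul_one]

/-- A quadratic partition of unity glues Schur multipliers without loss in the norm. -/
lemma SchurBound.glue {m m' : ι → κ → ℂ} {c : ℝ} (hc : 0 ≤ c) (h : SchurBound m c)
    (h' : SchurBound m' c) {p q : ι → ℝ} {p' q' : κ → ℝ} (hpq : ∀ i, p i ^ 2 + q i ^ 2 = 1)
    (hpq' : ∀ j, p' j ^ 2 + q' j ^ 2 = 1) :
    SchurBound (fun i j => (p i * p' j : ℂ) * m i j + (q i * q' j : ℂ) * m' i j) c :=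
  fun X K hK hX w v => by
  have e : ∑ i, ∑ j, w i * (((p i * p' j : ℂ) * m i j + (q i * q' j : ℂ) * m' i j) * X i j) * v j =
      ∑ i, ∑ j, (w i * p i) * (m i j * X i j) * (v j * p' j) +
      ∑ i, ∑ j, (w i * q i) * (m' i j * X i j) * (v j * q' j) := by
    simp only [← Finset.sum_add_distrib]
    exact Finset.sum_congr rfl fun i _ => Finset.sum_congr rfl fun j _ => by ring
  rw [e]
  have h1 := h X K hK hX (fun i => w i * p i) (fun j => v j * p' j)
  have h2 := h' X K hK hX (fun i => w i * q i) (fun j => v j * q' j)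
  have k1 := ellNorm_sq_add_sq hpq w
  have k2 := ellNorm_sq_add_sq hpq' v
  refine (norm_add_le _ _).trans ((add_le_add h1 h2).trans ?_)
  rw [← mul_add]
  refine mul_le_mul_of_nonneg_left ?_ (mul_nonneg hc hK)
  refine abs_le_of_sq_le_sq' ?_ (mul_nonneg (ellNorm_nonneg w) (ellNorm_nonneg v)) |>.2
  rw [mul_pow, ← k1, ← k2]
  nlinarith [sq_nonneg (ellNorm (fun i => w i * p i) * ellNorm (fun j => v j * q' j) -
    ellNorm (fun i => w i * q i) * ellNorm (fun j => v j * p' j))]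

lemma schurBound_integral {Ω : Type*} [MeasurableSpace Ω] {μ : Measure Ω} {m : Ω → ι → κ → ℂ}
    {c : Ω → ℝ} (hm : ∀ i j, Integrable (fun t => m t i j) μ) (hc : Integrable c μ)
    (h : ∀ t, SchurBound (m t) (c t)) :
    SchurBound (fun i j => ∫ t, m t i j ∂μ) (∫ t, c t ∂μ) := fun X K hK hX w v => by
  have e : ∑ i, ∑ j, w i * ((∫ t, m t i j ∂μ) * X i j) * v j =
      ∫ t, ∑ i, ∑ j, w i * (m t i j * X i j) * v j ∂μ := by
    rw [integral_finsetSum _ fun i _ => integrable_finsetSum _ fun j _ =>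
      (((hm i j).mul_const _).const_mul _).mul_const _]
    refine Finset.sum_congr rfl fun i _ => ?_
    rw [integral_finsetSum _ fun j _ => (((hm i j).mul_const _).const_mul _).mul_const _]
    refine Finset.sum_congr rfl fun j _ => ?_
    rw [integral_mul_const, integral_const_mul, integral_mul_const]
  rw [e, ← integral_mul_const, ← integral_mul_const]
  exact norm_integral_le_of_norm_le ((hc.mul_const _).mul_const _)
    (Filter.Eventually.of_forall fun t => h t X K hK hX w v)

end Schur

section DividedDifference

/-- The divided difference of `t ↦ e ^ (2πiξt)`. -/
noncomputable def expDivDiff (ξ x y : ℝ) : ℂ :=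
  ∫ s in Set.Ioc (0 : ℝ) 1, (2 * Real.pi * ξ * Complex.I) *
    Complex.exp (2 * Real.pi * ξ * (s * x + (1 - s) * y) * Complex.I)

lemma norm_exp_eq_one_of_eq_ofReal_mul_I (t : ℝ) {z : ℂ} (hz : z = t * Complex.I) :
    ‖Complex.exp z‖ = 1 := by
  rw [hz, Complex.norm_exp_ofReal_mul_I]

lemma expDivDiff_mul_sub (ξ x y : ℝ) :
    expDivDiff ξ x y * (x - y) = Complex.exp (2 * Real.pi * ξ * x * Complex.I) -
      Complex.exp (2 * Real.pi * ξ * y * Complex.I) := by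
  have h := intervalIntegral.integral_eq_sub_of_hasDerivAt (a := 0) (b := 1)
    (f := fun s : ℝ => Complex.exp (2 * Real.pi * ξ * (s * x + (1 - s) * y) * Complex.I))
    (f' := fun s : ℝ => (2 * Real.pi * ξ * Complex.I) *
      Complex.exp (2 * Real.pi * ξ * (s * x + (1 - s) * y) * Complex.I) * (x - y))
    (fun s _ => by
      have h1 : HasDerivAt (fun s : ℝ => (s : ℂ)) 1 s := Complex.ofRealCLM.hasDerivAt
      have h2 := ((((h1.mul_const (x : ℂ)).add ((h1.const_sub 1).mul_const (y : ℂ))).const_mul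
        (2 * Real.pi * ξ : ℂ)).mul_const Complex.I).cexp
      refine h2.congr_deriv ?_
      simp only [Pi.add_apply]
      ring)
    (Continuous.intervalIntegrable (by fun_prop) _ _)
  rw [intervalIntegral.integral_of_le zero_le_one, integral_mul_const] at h
  rw [expDivDiff, h]
  simp

lemma norm_expDivDiff_le (ξ x y : ℝ) : ‖expDivDiff ξ x y‖ ≤ 2 * Real.pi * |ξ| := by
  have h := norm_setIntegral_le_of_norm_le_const (μ := volume) (s := Set.Ioc (0 : ℝ) 1)
    (C := 2 * Real.pi * |ξ|) (f := fun s : ℝ => (2 * Real.pi * ξ * Complex.I) *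
      Complex.exp (2 * Real.pi * ξ * (s * x + (1 - s) * y) * Complex.I)) (by simp)
    (fun s _ => by
      rw [norm_mul, norm_exp_eq_one_of_eq_ofReal_mul_I (2 * Real.pi * ξ * (s * x + (1 - s) * y))
        (by push_cast; ring)]
      simp [abs_of_pos Real.pi_pos])
  simpa [expDivDiff] using h

lemma continuous_expDivDiff (x y : ℝ) : Continuous fun ξ => expDivDiff ξ x y := by
  have : ∀ ξ, expDivDiff ξ x y = ∫ s in (0 : ℝ)..1, (2 * Real.pi * ξ * Complex.I) *
    Complex.exp (2 * Real.pi * ξ * (s * x + (1 - s) * y) * Complex.I) := fun ξ => by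
      rw [intervalIntegral.integral_of_le zero_le_one, expDivDiff]
  simp only [this]
  exact intervalIntegral.continuous_parametric_intervalIntegral_of_continuous'
    (by unfold Function.uncurry; fun_prop) _ _

variable {ι κ : Type*} [Fintype ι] [Fintype κ]

lemma schurBound_expDivDiff (a : ι → ℝ) (b : κ → ℝ) (ξ : ℝ) :
    SchurBound (fun i j => expDivDiff ξ (a i) (b j)) (2 * Real.pi * |ξ|) := by
  have h := schurBound_integral (μ := volume.restrict (Set.Ioc (0 : ℝ) 1))
    (c := fun _ => 2 * Real.pi * |ξ|)
    (m := fun s i j => (2 * Real.pi * ξ * Complex.I) *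
      Complex.exp (2 * Real.pi * ξ * (s * a i + (1 - s) * b j) * Complex.I))
    (fun i j => (Continuous.integrableOn_Ioc (by fun_prop)))
    (integrable_const _)
    (fun s => by
      have h1 := (schurBound_right (ι := ι) (d := 1) zero_le_one
        (g := fun j => Complex.exp (2 * Real.pi * ξ * ((1 - s) * b j) * Complex.I)) fun j =>
          (norm_exp_eq_one_of_eq_ofReal_mul_I (2 * Real.pi * ξ * ((1 - s) * b j))
            (by push_cast; ring)).le).left_mul zero_le_one
        (d := 2 * Real.pi * |ξ|) (by positivity)
        (g := fun i => (2 * Real.pi * ξ * Complex.I) *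
          Complex.exp (2 * Real.pi * ξ * (s * a i) * Complex.I))
        fun i => by
          rw [norm_mul, norm_exp_eq_one_of_eq_ofReal_mul_I (2 * Real.pi * ξ * (s * a i))
            (by push_cast; ring)]
          simp [abs_of_pos Real.pi_pos]
      rw [mul_one] at h1
      refine h1.congr fun i j => ?_
      rw [mul_assoc (_ * _) (Complex.exp _), ← Complex.exp_add]
      ring_nf)
  simpa [expDivDiff] using h

/-- A function whose derivative has an integrable Fourier transform is operator Lipschitz. -/
lemma exists_schurBound_divDiff_of_fourier {φ g : ℝ → ℂ} (hg : Continuous g)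
    (hgi : Integrable g) (hint : Integrable fun ξ : ℝ => ‖ξ‖ ^ 1 * ‖g ξ‖)
    (hφ : ∀ x : ℝ, φ x = ∫ ξ : ℝ, g ξ * Complex.exp (2 * Real.pi * ξ * x * Complex.I)) :
    ∃ (k : ℝ → ℝ → ℂ) (M : ℝ), 0 ≤ M ∧ (∀ x y, k x y * (x - y) = φ x - φ y) ∧
      ∀ {ι κ : Type} [Fintype ι] [Fintype κ] (a : ι → ℝ) (b : κ → ℝ),
        SchurBound (fun i j => k (a i) (b j)) M := by
  have hc : Integrable fun ξ : ℝ => ‖g ξ‖ * (2 * Real.pi * |ξ|) := by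
    refine (hint.const_mul (2 * Real.pi)).congr (Filter.Eventually.of_forall fun ξ => ?_)
    simp only [Real.norm_eq_abs]
    ring
  have hm : ∀ x y, Integrable fun ξ : ℝ => g ξ * expDivDiff ξ x y := fun x y => by
    refine hc.mono' (hg.mul (continuous_expDivDiff x y)).aestronglyMeasurable
      (Filter.Eventually.of_forall fun ξ => ?_)
    rw [norm_mul]
    exact mul_le_mul_of_nonneg_left (norm_expDivDiff_le ξ x y) (norm_nonneg _)
  refine ⟨fun x y => ∫ ξ : ℝ, g ξ * expDivDiff ξ x y, ∫ ξ : ℝ, ‖g ξ‖ * (2 * Real.pi * |ξ|),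
    integral_nonneg fun ξ => by positivity, fun x y => ?_, fun a b => ?_⟩
  · have hI : ∀ x : ℝ, Integrable fun ξ : ℝ =>
        g ξ * Complex.exp (2 * Real.pi * ξ * x * Complex.I) := fun x => by
      refine hgi.norm.mono' (hg.mul (by fun_prop)).aestronglyMeasurable
        (Filter.Eventually.of_forall fun ξ => ?_)
      rw [norm_mul, norm_exp_eq_one_of_eq_ofReal_mul_I (2 * Real.pi * ξ * x) (by push_cast; ring),
        mul_one]
    rw [← integral_mul_const, hφ x, hφ y, ← integral_sub (hI x) (hI y)]
    refine integral_congr_ae (Filter.Eventually.of_forall fun ξ => ?_)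
    simp only
    rw [mul_assoc, expDivDiff_mul_sub, mul_sub]
  · exact schurBound_integral (fun i j => hm _ _) hc fun ξ =>
      (schurBound_expDivDiff a b ξ).left_mul (g := fun _ => g ξ) (by positivity)
        (norm_nonneg _) fun _ => le_rfl

open FourierTransform in
lemma SchwartzMap.exists_schurBound_divDiff (φ : SchwartzMap ℝ ℂ) :
    ∃ (k : ℝ → ℝ → ℂ) (M : ℝ), 0 ≤ M ∧ (∀ x y, k x y * (x - y) = φ x - φ y) ∧
      ∀ {ι κ : Type} [Fintype ι] [Fintype κ] (a : ι → ℝ) (b : κ → ℝ),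
        SchurBound (fun i j => k (a i) (b j)) M := by
  refine exists_schurBound_divDiff_of_fourier (SchwartzMap.continuous (𝓕 φ))
    (SchwartzMap.integrable (𝓕 φ)) (SchwartzMap.integrable_pow_mul volume (𝓕 φ) 1) fun x => ?_
  have h : φ x = 𝓕⁻ (𝓕 (φ : ℝ → ℂ)) x := by
    rw [← SchwartzMap.fourier_coe, ← SchwartzMap.fourierInv_coe, fourierInv_fourier_eq]
  rw [h, Real.fourierInv_eq', SchwartzMap.fourier_coe]
  refine integral_congr_ae (Filter.Eventually.of_forall fun ξ => ?_)
  simp only [smul_eq_mul]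
  rw [mul_comm]
  congr 2
  simp
  ring

/-- Smooth compactly supported functions are operator Lipschitz. -/
lemma exists_schurBound_divDiff {φ : ℝ → ℝ} (hφ : ContDiff ℝ (⊤ : ℕ∞) φ)
    (hs : HasCompactSupport φ) :
    ∃ (k : ℝ → ℝ → ℂ) (M : ℝ), 0 ≤ M ∧ (∀ x y, k x y * (x - y) = φ x - φ y) ∧
      ∀ {ι κ : Type} [Fintype ι] [Fintype κ] (a : ι → ℝ) (b : κ → ℝ),
        SchurBound (fun i j => k (a i) (b j)) M := by
  have h1 : HasCompactSupport fun x => (φ x : ℂ) := hs.comp_left Complex.ofReal_zero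
  have h2 : ContDiff ℝ (⊤ : ℕ∞) fun x => (φ x : ℂ) := Complex.ofRealCLM.contDiff.comp hφ
  exact (h1.toSchwartzMap h2).exists_schurBound_divDiff

end DividedDifference

section Cutoff

lemma schurBound_sub_mul_bump {ι κ : Type*} [Fintype ι] [Fintype κ] {φ : ℝ → ℝ}
    {k : ℝ → ℝ → ℂ} {M L : ℝ} (hφ1 : ∀ x, |φ x| ≤ 1) (hφ2 : ∀ x, φ x ≠ 0 → |x| < 2)
    (hM : 0 ≤ M) (hk : ∀ x y, k x y * (x - y) = φ x - φ y) (a : ι → ℝ) (b : κ → ℝ)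
    (hkM : SchurBound (fun i j => k (a i) (b j)) M) (hL : 0 ≤ L) {u : ι → ℂ} {v : κ → ℂ}
    (hu : ∀ i, ‖u i‖ ≤ L * |a i|) (hv : ∀ j, ‖v j‖ ≤ L * |b j|) :
    SchurBound (fun i j => (u i - v j) * ((φ (a i) - φ (b j)) * k (a i) (b j)))
      ((8 * M + 4) * L) := by
  have hφ1' : ∀ x, ‖(φ x : ℂ)‖ ≤ 1 := fun x => by simpa using hφ1 x
  have hφ3 : ∀ x, ‖(x * φ x : ℂ)‖ ≤ 2 := fun x => by
    by_cases h : φ x = 0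
    · simp [h]
    · rw [norm_mul, ← mul_one (2 : ℝ)]
      gcongr
      · simpa using (hφ2 x h).le
      · exact hφ1' x
  have quot : ∀ {z : ℂ} {x : ℝ}, ‖z‖ ≤ L * |x| → ‖z / x‖ ≤ L ∧ z = z / x * x := by
    intro z x h
    rcases eq_or_ne x 0 with rfl | hx
    · have : z = 0 := by simpa using h
      simp [this, hL]
    · have hx' : (x : ℂ) ≠ 0 := by exact_mod_cast hx
      refine ⟨?_, by field_simp⟩
      rw [norm_div, Complex.norm_real, Real.norm_eq_abs, div_le_iff₀ (abs_pos.2 hx)]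
      exact h
  have vanish : ∀ {z : ℂ} {x : ℝ}, ‖z‖ ≤ L * |x| → ‖z * φ x‖ ≤ 2 * L := by
    intro z x h
    rw [(quot h).2, mul_assoc, norm_mul, mul_comm 2 L]
    gcongr
    exacts [(quot h).1, hφ3 x]
  have hxy := (schurBound_right (ι := ι) (g := fun j => (φ (b j) : ℂ)) zero_le_one
    fun j => hφ1' _).left_mul (g := fun i => (φ (a i) : ℂ)) zero_le_one zero_le_one fun i => hφ1' _
  have hyy := (schurBound_right (ι := ι) (g := fun j => (φ (b j) : ℂ)) zero_le_one
    fun j => hφ1' _).right_mul (g := fun j => (φ (b j) : ℂ)) zero_le_one zero_le_one fun i => hφ1' _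
  have hxx := (schurBound_left (κ := κ) (g := fun i => (φ (a i) : ℂ)) zero_le_one
    fun i => hφ1' _).left_mul (g := fun i => (φ (a i) : ℂ)) zero_le_one zero_le_one fun i => hφ1' _
  have h1 := hkM.left_mul hM (by positivity) fun i => vanish (hu i)
  have h2 := ((hxy.add hyy.neg).add (hkM.right_mul hM zero_le_two fun j => hφ3 (b j))).left_mul
    (by positivity) hL fun i => (quot (hu i)).1
  have h3 := ((hxx.add hxy.neg).neg.add
    (hkM.left_mul hM zero_le_two fun i => hφ3 (a i))).right_mul
    (by positivity) hL fun j => (quot (hv j)).1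
  have h4 := hkM.right_mul hM (by positivity) fun j => vanish (hv j)
  refine (((h1.add h2.neg).add h3.neg).add h4).congr (fun i j => ?_) |>.mono (by linarith)
  have e := hk (a i) (b j)
  have e1 := (quot (hu i)).2
  have e2 := (quot (hv j)).2
  set U := u i / a i
  set V := v j / b j
  rw [e1, e2]
  linear_combination (V * φ (a i) - U * φ (b j)) * e

/-- A smooth quadratic partition of unity `p ^ 2 + q ^ 2 = 1`, with `p` living near the origin and
`q` away from the origin, for which the kernel `(1 - p x p y - q x q y) / (x - y)` remains a Schur
multiplier after multiplication by functions of linear growth. -/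
lemma exists_cutoff :
    ∃ (p q : ℝ → ℝ) (h : ℝ → ℝ → ℂ) (M : ℝ), 0 ≤ M ∧ (∀ x, p x ^ 2 + q x ^ 2 = 1) ∧
      (∀ x, p x ≠ 0 → |x| < 2) ∧ (∀ x, q x ≠ 0 → 1 < |x|) ∧
      (∀ x y, h x y * (x - y) = 1 - p x * p y - q x * q y) ∧
      ∀ {ι κ : Type} [Fintype ι] [Fintype κ] (a : ι → ℝ) (b : κ → ℝ) (L : ℝ) (_ : 0 ≤ L)
        (u : ι → ℂ) (v : κ → ℂ) (_ : ∀ i, ‖u i‖ ≤ L * |a i|) (_ : ∀ j, ‖v j‖ ≤ L * |b j|),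
        SchurBound (fun i j => (u i - v j) * h (a i) (b j)) (M * L) := by
  set θ : ℝ → ℝ := fun x => Real.pi / 2 * Real.smoothTransition (x ^ 2 - 1) with hθ
  have hθs : ContDiff ℝ (⊤ : ℕ∞) θ := by
    have : ContDiff ℝ (⊤ : ℕ∞) fun x : ℝ => x ^ 2 - 1 := by fun_prop
    exact contDiff_const.mul (Real.smoothTransition.contDiff.comp this)
  have hθ2 : ∀ x, 2 ≤ |x| → θ x = Real.pi / 2 := fun x hx => by
    have : 1 ≤ x ^ 2 - 1 := by nlinarith [sq_abs x]
    simp [hθ, Real.smoothTransition.one_of_one_le this]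
  have hθ1 : ∀ x, |x| ≤ 1 → θ x = 0 := fun x hx => by
    have : x ^ 2 - 1 ≤ 0 := by nlinarith [sq_abs x, abs_nonneg x]
    simp [hθ, Real.smoothTransition.zero_of_nonpos this]
  have hθ0 : ∀ x, 0 ≤ Real.sin (θ x) := fun x => by
    have h0 := Real.smoothTransition.nonneg (x ^ 2 - 1)
    have h1 := Real.smoothTransition.le_one (x ^ 2 - 1)
    have := Real.pi_pos
    refine Real.sin_nonneg_of_nonneg_of_le_pi (by positivity) ?_
    simp only [hθ]
    nlinarith
  have supp : ∀ {φ : ℝ → ℝ}, (∀ x, 2 ≤ |x| → φ x = 0) → HasCompactSupport φ := fun h =>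
    HasCompactSupport.of_support_subset_isCompact (isCompact_closedBall (0 : ℝ) 2) fun x hx => by
      by_contra hn
      exact hx (h x (by simpa using (not_le.1 (by simpa using hn)).le))
  have hp2 : ∀ x, 2 ≤ |x| → Real.cos (θ x) = 0 := fun x hx => by simp [hθ2 x hx]
  have hq2 : ∀ x, 2 ≤ |x| → 1 - Real.sin (θ x) = 0 := fun x hx => by simp [hθ2 x hx]
  obtain ⟨k, M, hM, hk, hkM⟩ := exists_schurBound_divDiff (Real.contDiff_cos.comp hθs) (supp hp2)
  obtain ⟨k', M', hM', hk', hkM'⟩ := exists_schurBound_divDiff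
    (φ := fun x => 1 - Real.sin (θ x)) (contDiff_const.sub (Real.contDiff_sin.comp hθs)) (supp hq2)
  simp only [Function.comp_apply] at hk
  refine ⟨fun x => Real.cos (θ x), fun x => Real.sin (θ x), fun x y =>
    2⁻¹ * ((Real.cos (θ x) - Real.cos (θ y) : ℂ) * k x y +
      (((1 - Real.sin (θ x) : ℝ) : ℂ) - ((1 - Real.sin (θ y) : ℝ) : ℂ)) * k' x y),
    2⁻¹ * ((8 * M + 4) + (8 * M' + 4)), by positivity, fun x => Real.cos_sq_add_sin_sq _,
    fun x hx => ?_, fun x hx => ?_, fun x y => ?_, fun a b L hL u v hu hv => ?_⟩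
  · by_contra! hn
    exact hx (hp2 x hn)
  · by_contra! hn
    exact hx (by simp [hθ1 x hn])
  · have e := hk x y
    have e' := hk' x y
    have i1 : (Real.cos (θ x) : ℂ) ^ 2 + (Real.sin (θ x) : ℂ) ^ 2 = 1 := by
      exact_mod_cast Real.cos_sq_add_sin_sq _
    have i2 : (Real.cos (θ y) : ℂ) ^ 2 + (Real.sin (θ y) : ℂ) ^ 2 = 1 := by
      exact_mod_cast Real.cos_sq_add_sin_sq _
    push_cast only [Complex.ofReal_sub, Complex.ofReal_one] at e' ⊢
    linear_combination 2⁻¹ * (Real.cos (θ x) - Real.cos (θ y) : ℂ) * e +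
      2⁻¹ * (Real.sin (θ y) - Real.sin (θ x) : ℂ) * e' + 2⁻¹ * i1 + 2⁻¹ * i2
  · have h1 := schurBound_sub_mul_bump (φ := fun x => Real.cos (θ x))
      (fun x => Real.abs_cos_le_one _) (fun x hx => by
        by_contra! hn
        exact hx (hp2 x hn)) hM hk a b (hkM a b) hL hu hv
    have h2 := schurBound_sub_mul_bump (φ := fun x => 1 - Real.sin (θ x))
      (fun x => abs_le.2 ⟨by linarith [Real.sin_le_one (θ x)], by linarith [hθ0 x]⟩)
      (fun x hx => by
        by_contra! hn
        exact hx (hq2 x hn)) hM' hk' a b (hkM' a b) hL hu hv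
    refine ((h1.add h2).left_mul (g := fun _ => (2⁻¹ : ℂ)) (d := 2⁻¹) (by positivity)
      (by norm_num) fun _ => by norm_num).congr (fun i j => by ring) |>.mono (by linarith)

end Cutoff

section Recursion

/-- A finite set of reals has a window which, with its double, splits the set in a balanced way. -/
lemma exists_balanced_window (T : Finset ℝ) (hT : 6 ≤ T.card) :
    ∃ c ∈ T, ∃ r : ℝ, 0 < r ∧ 5 * (T.filter fun x => |x - c| < 2 * r).card ≤ 4 * T.card ∧
      5 * (T.filter fun x => r < |x - c|).card ≤ 4 * T.card := by
  classical
  obtain ⟨m, hm⟩ : ∃ m, m = (T.card + 4) / 5 := ⟨_, rfl⟩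
  set P := (T ×ˢ T).filter fun z => z.1 < z.2 ∧ m ≤ (T.filter fun x => z.1 ≤ x ∧ x ≤ z.2).card
    with hP
  have hsub : ∀ U ⊆ T, m ≤ U.card → ∀ t ℓ : ℝ, (∀ x ∈ U, t ≤ x ∧ x < t + ℓ) →
      ∃ z ∈ P, z.2 - z.1 < ℓ := by
    intro U hU hmU t ℓ hx
    have hne : U.Nontrivial := Finset.one_lt_card_iff_nontrivial.1 (by omega)
    have hn := hne.nonempty
    refine ⟨(U.min' hn, U.max' hn), ?_, ?_⟩
    · simp only [hP, Finset.mem_filter, Finset.mem_product]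
      refine ⟨⟨hU (U.min'_mem hn), hU (U.max'_mem hn)⟩,
        U.min'_lt_max'_of_card (by omega), hmU.trans (Finset.card_le_card fun x hxU => ?_)⟩
      exact Finset.mem_filter.2 ⟨hU hxU, U.min'_le x hxU, U.le_max' x hxU⟩
    · have h1 := hx _ (U.min'_mem hn)
      have h2 := hx _ (U.max'_mem hn)
      simp only
      linarith
  have hTn : T.Nonempty := Finset.card_pos.1 (by omega)
  have hPn : P.Nonempty := by
    obtain ⟨z, hz, -⟩ := hsub T subset_rfl (by omega) (T.min' hTn) (T.max' hTn - T.min' hTn + 1)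
      fun x hx => ⟨T.min'_le x hx, by linarith [T.le_max' x hx]⟩
    exact ⟨z, hz⟩
  obtain ⟨⟨c, d⟩, hz, hmin⟩ := P.exists_min_image (fun z => z.2 - z.1) hPn
  simp only [hP, Finset.mem_filter, Finset.mem_product] at hz
  obtain ⟨⟨hc, -⟩, hcd, hcard⟩ := hz
  have hsmall : ∀ t : ℝ, (T.filter fun x => t ≤ x ∧ x < t + (d - c)).card ≤ m - 1 := by
    intro t
    by_contra! hn
    obtain ⟨z, hz, hlt⟩ := hsub (T.filter fun x => t ≤ x ∧ x < t + (d - c))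
      (Finset.filter_subset _ _) (by omega) t (d - c) fun x hx => (Finset.mem_filter.1 hx).2
    exact (hmin z hz).not_gt hlt
  refine ⟨c, hc, d - c, sub_pos.2 hcd, ?_, ?_⟩
  · set I : ℝ → Finset ℝ := fun t => T.filter fun x => t ≤ x ∧ x < t + (d - c)
    have hcov : (T.filter fun x => |x - c| < 2 * (d - c)) ⊆
        (I (c - 2 * (d - c)) ∪ I (c - (d - c))) ∪ (I c ∪ I (c + (d - c))) := by
      intro x hx
      obtain ⟨hxT, hx⟩ := Finset.mem_filter.1 hx
      obtain ⟨h1, h2⟩ := abs_lt.1 hx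
      simp only [I, Finset.mem_union, Finset.mem_filter, hxT, true_and]
      rcases lt_or_ge x c with h3 | h3
      · left
        rcases lt_or_ge x (c - (d - c)) with h4 | h4
        · exact Or.inl ⟨by linarith, by linarith⟩
        · exact Or.inr ⟨by linarith, by linarith⟩
      · right
        rcases lt_or_ge x (c + (d - c)) with h4 | h4
        · exact Or.inl ⟨by linarith, by linarith⟩
        · exact Or.inr ⟨by linarith, by linarith⟩
    have h0 := Finset.card_le_card hcov
    have h1 := Finset.card_union_le (I (c - 2 * (d - c)) ∪ I (c - (d - c)))
      (I c ∪ I (c + (d - c)))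
    have h2 := Finset.card_union_le (I (c - 2 * (d - c))) (I (c - (d - c)))
    have h3 := Finset.card_union_le (I c) (I (c + (d - c)))
    have k1 : (I (c - 2 * (d - c))).card ≤ m - 1 := hsmall _
    have k2 : (I (c - (d - c))).card ≤ m - 1 := hsmall _
    have k3 : (I c).card ≤ m - 1 := hsmall _
    have k4 : (I (c + (d - c))).card ≤ m - 1 := hsmall _
    omega
  · have hdis : Disjoint (T.filter fun x => d - c < |x - c|)
        (T.filter fun x => c ≤ x ∧ x ≤ d) := by
      refine Finset.disjoint_filter.2 fun x _ h1 h2 => ?_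
      rw [abs_of_nonneg (sub_nonneg.2 h2.1)] at h1
      linarith [h2.2]
    have h1 := Finset.card_le_card (Finset.union_subset
      (Finset.filter_subset (fun x => d - c < |x - c|) T)
      (Finset.filter_subset (fun x => c ≤ x ∧ x ≤ d) T))
    rw [Finset.card_union_of_disjoint hdis] at h1
    omega

/-- The divided difference of `f` restricted to `T × T`, extended by zero. -/
noncomputable def divDiffOn (f : ℝ → ℂ) (T : Finset ℝ) (x y : ℝ) : ℂ :=
  (T : Set ℝ).indicator 1 x * (T : Set ℝ).indicator 1 y * ((f x - f y) / (x - y))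

lemma norm_indicator_one_le (T : Set ℝ) (x : ℝ) : ‖T.indicator (1 : ℝ → ℂ) x‖ ≤ 1 := by
  by_cases h : x ∈ T <;> simp [h]

lemma norm_divDiffOn_le {f : ℝ → ℂ} {T : Finset ℝ} {L : ℝ} (hL : 0 ≤ L)
    (hf : ∀ x ∈ T, ∀ y ∈ T, ‖f x - f y‖ ≤ L * |x - y|) (x y : ℝ) : ‖divDiffOn f T x y‖ ≤ L := by
  by_cases hx : x ∈ T
  · by_cases hy : y ∈ T
    · rw [divDiffOn, Set.indicator_of_mem (by simpa using hx),
        Set.indicator_of_mem (by simpa using hy)]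
      simp only [Pi.one_apply, one_mul, norm_div, ← Complex.ofReal_sub, Complex.norm_real,
        Real.norm_eq_abs]
      exact div_le_of_le_mul₀ (abs_nonneg _) hL (hf x hx y hy)
    · simp [divDiffOn, hy, hL]
  · simp [divDiffOn, hx, hL]

lemma schurBound_divDiffOn_card {ι κ : Type*} [Fintype ι] [Fintype κ] (a : ι → ℝ) (b : κ → ℝ)
    {f : ℝ → ℂ} {T : Finset ℝ} {L : ℝ} (hL : 0 ≤ L)
    (hf : ∀ x ∈ T, ∀ y ∈ T, ‖f x - f y‖ ≤ L * |x - y|) :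
    SchurBound (fun i j => divDiffOn f T (a i) (b j)) (T.card * L) := by
  classical
  refine (schurBound_sum T (c := L) (m := fun s i j => (if a i = s then 1 else 0) *
    divDiffOn f T s (b j)) fun s _ => ?_).congr fun i j => ?_
  · have h := (schurBound_right (ι := ι) hL fun j => norm_divDiffOn_le hL hf s (b j)).left_mul
      (g := fun i => if a i = s then 1 else 0) hL zero_le_one fun i => by split_ifs <;> simp
    simpa using h
  · simp only [ite_mul, one_mul, zero_mul, Finset.sum_ite_eq]
    split_ifs with h
    · rfl
    · simp [divDiffOn, h]

lemma exists_schurBound_divDiffOn :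
    ∃ C : ℝ, 0 < C ∧ ∀ {ι κ : Type} [Fintype ι] [Fintype κ] (a : ι → ℝ) (b : κ → ℝ)
      (f : ℝ → ℂ) (L : ℝ) (_ : 0 ≤ L) (T : Finset ℝ)
      (_ : ∀ x ∈ T, ∀ y ∈ T, ‖f x - f y‖ ≤ L * |x - y|) (t : ℝ) (_ : 1 ≤ t) (_ : T.card ≤ t),
      SchurBound (fun i j => divDiffOn f T (a i) (b j)) (C * (1 + Real.log t) * L) := by
  obtain ⟨p, q, h, M, hM, hpq, hp, hq, hh, hS⟩ := exists_cutoff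
  have hlog : 0 < Real.log (5 / 4) := Real.log_pos (by norm_num)
  obtain ⟨C, hC5, hCM⟩ : ∃ C : ℝ, 5 ≤ C ∧ M ≤ C * Real.log (5 / 4) := by
    refine ⟨5 + M / Real.log (5 / 4), by linarith [div_nonneg hM hlog.le], ?_⟩
    rw [add_mul, div_mul_cancel₀ _ hlog.ne']
    linarith
  refine ⟨C, by linarith, ?_⟩
  intro ι κ _ _ a b f L hL T
  induction T using Finset.strongInduction with
  | H T ih =>
  intro hf t ht hTt
  have hlt : 0 ≤ Real.log t := Real.log_nonneg ht
  rcases Nat.lt_or_ge T.card 6 with h6 | h6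
  · refine (schurBound_divDiffOn_card a b hL hf).mono ?_
    have : (T.card : ℝ) ≤ 5 := by exact_mod_cast Nat.lt_succ_iff.1 h6
    gcongr
    nlinarith
  have h6' : (6 : ℝ) ≤ T.card := by exact_mod_cast h6
  obtain ⟨c, hc, r, hr, hT1, hT2⟩ := exists_balanced_window T h6
  set T1 := T.filter fun x => |x - c| < 2 * r
  set T2 := T.filter fun x => r < |x - c|
  have hsub : ∀ U ⊆ T, 5 * U.card ≤ 4 * T.card →
      SchurBound (fun i j => divDiffOn f U (a i) (b j)) (C * (1 + Real.log (4 / 5 * t)) * L) := by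
    intro U hU hcard
    have hcard' : (5 * U.card : ℝ) ≤ 4 * T.card := by exact_mod_cast hcard
    refine ih U (Finset.ssubset_iff_subset_ne.2 ⟨hU, ?_⟩)
      (fun x hx y hy => hf x (hU hx) y (hU hy)) _ (by linarith) (by linarith)
    rintro rfl
    omega
  have hlog' : Real.log (4 / 5 * t) = Real.log t - Real.log (5 / 4) := by
    rw [Real.log_mul (by norm_num) (by linarith), show (4 / 5 : ℝ) = (5 / 4)⁻¹ by norm_num,
      Real.log_inv]
    ring
  have hlog0 : 0 ≤ Real.log (4 / 5 * t) := Real.log_nonneg (by linarith)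
  have hg := (hsub T1 (Finset.filter_subset _ _) hT1).glue (by positivity)
    (hsub T2 (Finset.filter_subset _ _) hT2) (fun i => hpq ((a i - c) / r))
    (fun j => hpq ((b j - c) / r))
  set F : ℝ → ℂ := fun x => (T : Set ℝ).indicator 1 x * ((f x - f c) / r) with hF
  have hFb : ∀ x, ‖F x‖ ≤ L * |(x - c) / r| := by
    intro x
    by_cases hx : x ∈ T
    · simp only [hF, Set.indicator_of_mem (show x ∈ (T : Set ℝ) from hx), Pi.one_apply, one_mul,
        norm_div, abs_div, Complex.norm_real, Real.norm_eq_abs, ← mul_div_assoc]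
      gcongr
      exact hf x hx c hc
    · simp only [hF, Set.indicator_of_notMem (show x ∉ (T : Set ℝ) from hx), zero_mul, norm_zero]
      positivity
  have hcut := ((hS (fun i => (a i - c) / r) (fun j => (b j - c) / r) L hL (fun i => F (a i))
    (fun j => F (b j)) (fun i => hFb _) (fun j => hFb _)).left_mul
      (g := fun i => (T : Set ℝ).indicator 1 (a i)) (by positivity) zero_le_one
      fun i => norm_indicator_one_le _ _).right_mul
      (g := fun j => (T : Set ℝ).indicator 1 (b j)) (by positivity) zero_le_one
      fun i => norm_indicator_one_le _ _
  have hp' : ∀ x, (p ((x - c) / r) : ℂ) * (T1 : Set ℝ).indicator 1 x =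
      p ((x - c) / r) * (T : Set ℝ).indicator 1 x := by
    intro x
    by_cases h0 : p ((x - c) / r) = 0
    · simp [h0]
    · have h1 := hp _ h0
      rw [abs_div, abs_of_pos hr, div_lt_iff₀ hr] at h1
      congr 1
      simp [T1, Set.indicator_apply, h1]
  have hq' : ∀ x, (q ((x - c) / r) : ℂ) * (T2 : Set ℝ).indicator 1 x =
      q ((x - c) / r) * (T : Set ℝ).indicator 1 x := by
    intro x
    by_cases h0 : q ((x - c) / r) = 0
    · simp [h0]
    · have h1 := hq _ h0
      rw [abs_div, abs_of_pos hr, lt_div_iff₀ hr, one_mul] at h1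
      congr 1
      simp [T2, Set.indicator_apply, h1]
  refine ((hg.add hcut).congr fun i j => ?_).mono ?_
  · generalize a i = x
    generalize b j = y
    by_cases hx : x ∈ T
    swap
    · have hx1 : x ∉ T1 := fun h => hx (Finset.filter_subset _ _ h)
      have hx2 : x ∉ T2 := fun h => hx (Finset.filter_subset _ _ h)
      simp [divDiffOn, hx, hx1, hx2]
    by_cases hy : y ∈ T
    swap
    · have hy1 : y ∉ T1 := fun h => hy (Finset.filter_subset _ _ h)
      have hy2 : y ∉ T2 := fun h => hy (Finset.filter_subset _ _ h)
      simp [divDiffOn, hy, hy1, hy2]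
    rcases eq_or_ne x y with rfl | hxy
    · simp [divDiffOn]
    have hxy' : (x - y : ℂ) ≠ 0 := sub_ne_zero.2 (by exact_mod_cast hxy)
    have hr' : (r : ℂ) ≠ 0 := by exact_mod_cast hr.ne'
    have e := hh ((x - c) / r) ((y - c) / r)
    have px := hp' x
    have py := hp' y
    have qx := hq' x
    have qy := hq' y
    simp only [divDiffOn, hF]
    rw [Set.indicator_of_mem (show x ∈ (T : Set ℝ) from hx)] at px qx ⊢
    rw [Set.indicator_of_mem (show y ∈ (T : Set ℝ) from hy)] at py qy ⊢
    simp only [Pi.one_apply, mul_one, one_mul] at px py qx qy ⊢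
    have e' : h ((x - c) / r) ((y - c) / r) = (1 - p ((x - c) / r) * p ((y - c) / r) -
        q ((x - c) / r) * q ((y - c) / r)) * (r / (x - y)) := by
      rw [← e]
      push_cast
      field_simp
      ring
    have e2 : ((f x - f c) / r - (f y - f c) / r) * r = f x - f y := by
      field_simp
      ring
    rw [e']
    linear_combination (-(p ((x - c) / r) * (T1 : Set ℝ).indicator 1 x * py +
      p ((y - c) / r) * px + q ((x - c) / r) * (T2 : Set ℝ).indicator 1 x * qy +
      q ((y - c) / r) * qx)) * ((f x - f y) / (x - y)) -
      (1 - p ((x - c) / r) * p ((y - c) / r) - q ((x - c) / r) * q ((y - c) / r)) / (x - y) * e2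
  · rw [hlog']
    nlinarith [mul_le_mul_of_nonneg_right hCM hL]

end Recursion

section Operators

variable {H : Type} [NormedAddCommGroup H] [InnerProductSpace ℂ H]

section Bases

variable {ι κ : Type*} [Fintype ι] [Fintype κ] (e : OrthonormalBasis ι ℂ H)
  (e' : OrthonormalBasis κ ℂ H)

lemma ellNorm_repr (x : H) : ellNorm (fun i => e.repr x i) = ‖x‖ := by
  rw [← e.repr.norm_map x, EuclideanSpace.norm_eq, ellNorm]

lemma ellNorm_star (w : ι → ℂ) : ellNorm (fun i => star (w i)) = ellNorm w := by
  simp [ellNorm]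

lemma inner_eq_sum_matrix (Y : H →L[ℂ] H) (x y : H) :
    inner ℂ x (Y y) =
      ∑ i, ∑ j, star (e.repr x i) * inner ℂ (e i) (Y (e' j)) * e'.repr y j := by
  conv_lhs => rw [← e.sum_repr x, ← e'.sum_repr y, sum_inner]
  refine Finset.sum_congr rfl fun i _ => ?_
  rw [map_sum, inner_sum]
  refine Finset.sum_congr rfl fun j _ => ?_
  rw [map_smul, inner_smul_left, inner_smul_right, starRingEnd_apply]
  ring

lemma formBound_inner (Y : H →L[ℂ] H) :
    FormBound (fun i j => inner ℂ (e i) (Y (e' j))) ‖Y‖ := fun w v => by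
  set x := e.repr.symm (WithLp.toLp 2 fun i => star (w i))
  set y := e'.repr.symm (WithLp.toLp 2 v)
  have h := inner_eq_sum_matrix e e' Y x y
  have hx : ‖x‖ = ellNorm w := by simp [← ellNorm_repr e, x, ← ellNorm_star w]
  have hy : ‖y‖ = ellNorm v := by simp [← ellNorm_repr e', y]
  simp only [x, y, LinearIsometryEquiv.apply_symm_apply, star_star] at h
  rw [← h, ← hx, ← hy]
  calc _ ≤ ‖x‖ * ‖Y y‖ := norm_inner_le_norm _ _
    _ ≤ ‖x‖ * (‖Y‖ * ‖y‖) := by gcongr; exact Y.le_opNorm y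
    _ = _ := by ring

lemma opNorm_le_of_formBound {Y : H →L[ℂ] H} {c : ℝ} (hc : 0 ≤ c)
    (h : FormBound (fun i j => inner ℂ (e i) (Y (e' j))) c) : ‖Y‖ ≤ c := by
  refine ContinuousLinearMap.opNorm_le_of_re_inner_le hc fun y x hy hx => ?_
  rw [inner_re_symm]
  refine (RCLike.re_le_norm _).trans ?_
  rw [inner_eq_sum_matrix e e' Y x y]
  refine (h _ _).trans_eq ?_
  rw [ellNorm_star, ellNorm_repr e, ellNorm_repr e', hx, hy, one_mul, mul_one]

lemma inner_basis_apply_of_diagonal {Y : H →L[ℂ] H} {g : ι → ℂ} (hY : ∀ i, Y (e i) = g i • e i)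
    (i : ι) (z : H) : inner ℂ (e i) (Y z) = g i * inner ℂ (e i) z := by
  classical
  conv_lhs => rw [← e.sum_repr z]
  simp [hY, e.inner_eq_ite, e.repr_apply_apply, mul_comm]

lemma inner_commutator {A B : H →L[ℂ] H} (R : H →L[ℂ] H) {α : ι → ℂ} {β : κ → ℂ}
    (hA : ∀ i, A (e i) = α i • e i) (hB : ∀ j, B (e' j) = β j • e' j) (i : ι) (j : κ) :
    inner ℂ (e i) ((A * R - R * B) (e' j)) = (α i - β j) * inner ℂ (e i) (R (e' j)) := by
  rw [sub_apply, mul_apply_eq_comp, mul_apply_eq_comp, inner_sub_right,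
    inner_basis_apply_of_diagonal e hA, hB, map_smul, inner_smul_right, sub_mul]

end Bases

variable [FiniteDimensional ℂ H]

lemma spectrum_toLinearMap (A : H →L[ℂ] H) :
    spectrum ℂ (A : H →ₗ[ℂ] H) = spectrum ℂ A :=
  AlgEquiv.spectrum_eq (Module.End.toContinuousLinearMap H).symm A

lemma mem_spectrum_of_eigenvector {A : H →L[ℂ] H} {z : ℂ} {e : H} (he0 : e ≠ 0)
    (he : A e = z • e) : z ∈ spectrum ℂ A := by
  rw [← spectrum_toLinearMap]
  exact (Module.End.hasEigenvalue_of_hasEigenvector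
    ⟨Module.End.mem_eigenspace_iff.2 he, he0⟩).mem_spectrum

variable [CompleteSpace H]

lemma cfcC_apply_eigenvector {A : H →L[ℂ] H} (hA : IsSelfAdjoint A) (f : ℝ → ℂ) {x : ℝ} {e : H}
    (he : A e = (x : ℂ) • e) (hx : (x : ℂ) ∈ spectrum ℂ A) : cfcC f A e = f x • e := by
  have hfin : (spectrum ℂ A).Finite := by
    rw [← spectrum_toLinearMap]
    exact Module.End.finite_spectrum _
  set P := Lagrange.interpolate hfin.toFinset id fun z : ℂ => f z.re
  have hP : ∀ z ∈ spectrum ℂ A, P.eval z = f z.re := fun z hz =>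
    Lagrange.eval_interpolate_at_node (s := hfin.toFinset) (v := id) (fun z : ℂ => f z.re)
      Function.injective_id.injOn (hfin.mem_toFinset.2 hz)
  have hn : IsStarNormal A := hA.isStarNormal
  have hcfc : cfcC f A = Polynomial.aeval A P := by
    rw [← cfc_polynomial P A, cfcC]
    exact cfc_congr fun z hz => (hP z hz).symm
  have hcoe : ((Polynomial.aeval A P : H →L[ℂ] H) : H →ₗ[ℂ] H) =
      Polynomial.aeval (A : H →ₗ[ℂ] H) P :=
    (Polynomial.aeval_algHom_apply
      (Module.End.toContinuousLinearMap H).symm.toAlgHom A P).symm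
  rw [hcfc, ← ContinuousLinearMap.coe_coe, hcoe,
    Module.End.aeval_apply_of_mem_apply_eq_smul he, hP _ hx, Complex.ofReal_re]

lemma exists_eigenbasis {n : ℕ} (hn : Module.finrank ℂ H = n) {A : H →L[ℂ] H}
    (hA : IsSelfAdjoint A) :
    ∃ (e : OrthonormalBasis (Fin n) ℂ H) (a : Fin n → ℝ), (∀ i, A (e i) = (a i : ℂ) • e i) ∧
      (∀ i, a i ∈ spectrum ℝ A) ∧ ∀ (f : ℝ → ℂ) i, cfcC f A (e i) = f (a i) • e i := by
  have hS : (A : H →ₗ[ℂ] H).IsSymmetric :=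
    ContinuousLinearMap.isSelfAdjoint_iff_isSymmetric.1 hA
  have he : ∀ i, A (hS.eigenvectorBasis hn i) = (hS.eigenvalues hn i : ℂ) •
      hS.eigenvectorBasis hn i := fun i => hS.apply_eigenvectorBasis hn i
  have hm := fun i => mem_spectrum_of_eigenvector
    ((hS.eigenvectorBasis hn).orthonormal.ne_zero i) (he i)
  exact ⟨hS.eigenvectorBasis hn, hS.eigenvalues hn, he,
    fun i => (spectrum.algebraMap_mem_iff ℂ).1 (hm i),
    fun f i => cfcC_apply_eigenvector hA f (he i) (hm i)⟩

end Operators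

theorem stmt14 :
    ∃ C : ℝ, 0 < C ∧
      ∀ n : ℕ, 1 ≤ n →
        ∀ A B R : EuclideanSpace ℂ (Fin n) →L[ℂ] EuclideanSpace ℂ (Fin n),
          IsSelfAdjoint A → IsSelfAdjoint B →
          ∀ L : ℝ, 0 ≤ L →
          ∀ f : ℝ → ℂ, Continuous f →
            (∀ x ∈ spectrum ℝ A ∪ spectrum ℝ B, ∀ y ∈ spectrum ℝ A ∪ spectrum ℝ B,
              ‖f x - f y‖ ≤ L * |x - y|) →
            ‖cfcC f A * R - R * cfcC f B‖ ≤
              C * (1 + Real.log n) * L * ‖A * R - R * B‖ := by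
  obtain ⟨C, hC, hS⟩ := exists_schurBound_divDiffOn
  refine ⟨2 * C, by positivity, ?_⟩
  intro n hn A B R hA hB L hL f _ hf
  obtain ⟨e, a, hAe, ha, hfA⟩ := exists_eigenbasis finrank_euclideanSpace_fin hA
  obtain ⟨e', b, hBe, hb, hfB⟩ := exists_eigenbasis finrank_euclideanSpace_fin hB
  have hn' : (1 : ℝ) ≤ n := by exact_mod_cast hn
  have hlog : 0 ≤ Real.log n := Real.log_nonneg hn'
  set T : Finset ℝ := Finset.univ.image a ∪ Finset.univ.image b
  have haT : ∀ i, a i ∈ T := fun i =>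
    Finset.mem_union_left _ (Finset.mem_image_of_mem _ (Finset.mem_univ i))
  have hbT : ∀ j, b j ∈ T := fun j =>
    Finset.mem_union_right _ (Finset.mem_image_of_mem _ (Finset.mem_univ j))
  have hT : ∀ x ∈ T, x ∈ spectrum ℝ A ∪ spectrum ℝ B := fun x hx => by
    simp only [T, Finset.mem_union, Finset.mem_image, Finset.mem_univ, true_and] at hx
    obtain ⟨i, rfl⟩ | ⟨j, rfl⟩ := hx
    exacts [Or.inl (ha i), Or.inr (hb j)]
  have hcard : (T.card : ℝ) ≤ 2 * n := by
    have h1 : (Finset.univ.image a).card ≤ n := by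
      simpa using Finset.card_image_le (s := Finset.univ) (f := a)
    have h2 : (Finset.univ.image b).card ≤ n := by
      simpa using Finset.card_image_le (s := Finset.univ) (f := b)
    have h3 := Finset.card_union_le (Finset.univ.image a) (Finset.univ.image b)
    exact_mod_cast (h3.trans (by omega) : T.card ≤ 2 * n)
  have hbound := hS a b f L hL T (fun x hx y hy => hf x (hT x hx) y (hT y hy)) (2 * n)
    (by linarith) hcard _ _ (norm_nonneg _) (formBound_inner e e' (A * R - R * B))
  have hlog2 : Real.log (2 * n) ≤ 1 + 2 * Real.log n := by
    rw [Real.log_mul two_ne_zero (by linarith)]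
    linarith [Real.log_two_lt_d9]
  have hlog2' : 0 ≤ Real.log (2 * n) := Real.log_nonneg (by linarith)
  have hmat : (fun i j => inner ℂ (e i) ((cfcC f A * R - R * cfcC f B) (e' j))) =
      fun i j => divDiffOn f T (a i) (b j) * inner ℂ (e i) ((A * R - R * B) (e' j)) := by
    funext i j
    rw [inner_commutator e e' R (hfA f) (hfB f), inner_commutator e e' R hAe hBe, divDiffOn,
      Set.indicator_of_mem (Finset.mem_coe.2 (haT i)),
      Set.indicator_of_mem (Finset.mem_coe.2 (hbT j))]
    rcases eq_or_ne (a i) (b j) with h | h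
    · simp [h]
    · have h' : (a i - b j : ℂ) ≠ 0 := sub_ne_zero.2 (by exact_mod_cast h)
      simp only [Pi.one_apply, one_mul]
      field_simp
  rw [← hmat] at hbound
  refine (opNorm_le_of_formBound e e' (by positivity) hbound).trans ?_
  gcongr ?_ * L * _
  nlinarith
end

section
/- There exists a constant C > 0 with the following property. Let A and B be bounded self-adjoint operators on a complex Hilbert space H such that the spectrum σ(A) is a finite set with n ≥ 1 elements, let R be a bounded linear operator on H, let L ≥ 0, and let f : ℝ → ℂ be a continuous function satisfying |f(x) − f(y)| ≤ L·|x − y| for all x, y in σ(A) ∪ σ(B). Then ‖f(A)·R − R·f(B)‖ ≤ C · (1 + log n) · L · ‖A·R − R·B‖. -/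
open MeasureTheory ENNReal

section FunctionalCalculus

variable {H : Type} [NormedAddCommGroup H] [InnerProductSpace ℂ H] [CompleteSpace H]

lemma IsSelfAdjoint.re_mem_real_spectrum {A : H →L[ℂ] H} (hA : IsSelfAdjoint A) {z : ℂ}
    (hz : z ∈ spectrum ℂ A) : z.re ∈ spectrum ℝ A := by
  have h := hA.mem_spectrum_eq_re hz
  rw [h] at hz
  exact (spectrum.algebraMap_mem_iff ℂ).1 (by simpa using hz)

lemma IsSelfAdjoint.continuousOn_comp_re {A : H →L[ℂ] H} (hA : IsSelfAdjoint A) {f : ℝ → ℂ}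
    (hf : ContinuousOn f (spectrum ℝ A)) :
    ContinuousOn (fun z : ℂ => f z.re) (spectrum ℂ A) :=
  hf.comp Complex.continuous_re.continuousOn fun _ hz => hA.re_mem_real_spectrum hz

lemma cfcC_congr {A : H →L[ℂ] H} (hA : IsSelfAdjoint A) {f g : ℝ → ℂ}
    (h : ∀ x ∈ spectrum ℝ A, f x = g x) : cfcC f A = cfcC g A :=
  cfc_congr fun _ hz => h _ (hA.re_mem_real_spectrum hz)

lemma cfcC_mul {A : H →L[ℂ] H} (hA : IsSelfAdjoint A) {f g : ℝ → ℂ}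
    (hf : ContinuousOn f (spectrum ℝ A)) (hg : ContinuousOn g (spectrum ℝ A)) :
    cfcC (fun x => f x * g x) A = cfcC f A * cfcC g A :=
  cfc_mul _ _ A (hA.continuousOn_comp_re hf) (hA.continuousOn_comp_re hg)

lemma cfcC_add {A : H →L[ℂ] H} (hA : IsSelfAdjoint A) {f g : ℝ → ℂ}
    (hf : ContinuousOn f (spectrum ℝ A)) (hg : ContinuousOn g (spectrum ℝ A)) :
    cfcC (fun x => f x + g x) A = cfcC f A + cfcC g A :=
  cfc_add A _ _ (hA.continuousOn_comp_re hf) (hA.continuousOn_comp_re hg)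

lemma cfcC_sub {A : H →L[ℂ] H} (hA : IsSelfAdjoint A) {f g : ℝ → ℂ}
    (hf : ContinuousOn f (spectrum ℝ A)) (hg : ContinuousOn g (spectrum ℝ A)) :
    cfcC (fun x => f x - g x) A = cfcC f A - cfcC g A :=
  cfc_sub _ _ A (hA.continuousOn_comp_re hf) (hA.continuousOn_comp_re hg)

lemma cfcC_const {A : H →L[ℂ] H} (hA : IsSelfAdjoint A) (c : ℂ) :
    cfcC (fun _ => c) A = c • 1 := by
  have := hA.isStarNormal
  rw [cfcC, cfc_const c A, Algebra.algebraMap_eq_smul_one]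

lemma cfcC_id {A : H →L[ℂ] H} (hA : IsSelfAdjoint A) : cfcC (fun x => (x : ℂ)) A = A := by
  have := hA.isStarNormal
  have h : cfcC (fun x => (x : ℂ)) A = cfc (id : ℂ → ℂ) A :=
    cfc_congr fun z hz => (hA.mem_spectrum_eq_re hz).symm
  rw [h, cfc_id ℂ A]

lemma star_cfcC (f : ℝ → ℂ) (A : H →L[ℂ] H) :
    star (cfcC f A) = cfcC (fun x => star (f x)) A :=
  (cfc_star _ A).symm

lemma cfcC_commute (f g : ℝ → ℂ) (A : H →L[ℂ] H) : cfcC f A * cfcC g A = cfcC g A * cfcC f A :=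
  (cfc_commute_cfc _ _ A).eq

lemma norm_cfcC_le {A : H →L[ℂ] H} (hA : IsSelfAdjoint A) {f : ℝ → ℂ} {c : ℝ} (hc : 0 ≤ c)
    (h : ∀ x ∈ spectrum ℝ A, ‖f x‖ ≤ c) : ‖cfcC f A‖ ≤ c :=
  norm_cfc_le hc fun _ hz => h _ (hA.re_mem_real_spectrum hz)

open scoped ComplexOrder in
/-- If `|f| ≤ L |g|` on the spectrum of `A`, then `‖f(A) Z‖ ≤ L ‖g(A) Z‖`. -/
lemma norm_cfcC_mul_le_of_norm_le {A : H →L[ℂ] H} (hA : IsSelfAdjoint A) {f g : ℝ → ℂ}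
    (hf : ContinuousOn f (spectrum ℝ A)) (hg : ContinuousOn g (spectrum ℝ A)) {L : ℝ}
    (hL : 0 ≤ L) (h : ∀ x ∈ spectrum ℝ A, ‖f x‖ ≤ L * ‖g x‖) (Z : H →L[ℂ] H) :
    ‖cfcC f A * Z‖ ≤ L * ‖cfcC g A * Z‖ := by
  have hLg : ContinuousOn (fun x => (L : ℂ) * g x) (spectrum ℝ A) := by fun_prop
  have key : star (cfcC f A) * cfcC f A ≤
      star (cfcC (fun x => (L : ℂ) * g x) A) * cfcC (fun x => (L : ℂ) * g x) A := by
    rw [star_cfcC, star_cfcC, ← cfcC_mul hA (by fun_prop) hf, ← cfcC_mul hA (by fun_prop) hLg]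
    refine cfc_mono (fun z hz => ?_)
      (hA.continuousOn_comp_re (f := fun x => star (f x) * f x) (by fun_prop))
      (hA.continuousOn_comp_re (f := fun x => star (L * g x) * (L * g x)) (by fun_prop))
    have h1 := h _ (hA.re_mem_real_spectrum hz)
    simp only [RCLike.star_def, ← Complex.normSq_eq_conj_mul_self, Complex.normSq_eq_norm_sq]
    refine Complex.real_le_real.2 ?_
    rw [norm_mul, Complex.norm_real, Real.norm_of_nonneg hL]
    gcongr
  have key2 := CStarAlgebra.norm_le_norm_of_nonneg_of_le
    (star_left_conjugate_nonneg (star_mul_self_nonneg (cfcC f A)) Z)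
    (star_left_conjugate_le_conjugate key Z)
  have e (T : H →L[ℂ] H) : ‖star Z * (star T * T) * Z‖ = ‖T * Z‖ * ‖T * Z‖ := by
    rw [← CStarRing.norm_star_mul_self, star_mul]
    simp only [mul_assoc]
  rw [e, e] at key2
  have h3 : ‖cfcC f A * Z‖ ≤ ‖cfcC (fun x => (L : ℂ) * g x) A * Z‖ :=
    le_of_sq_le_sq (by simpa [sq] using key2)  (norm_nonneg _)
  rwa [cfcC_mul hA (by fun_prop) hg, cfcC_const hA, smul_mul_assoc, one_mul, smul_mul_assoc,
    norm_smul, Complex.norm_real, Real.norm_of_nonneg hL] at h3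

lemma norm_mul_cfcC_le_of_norm_le {A : H →L[ℂ] H} (hA : IsSelfAdjoint A) {f g : ℝ → ℂ}
    (hf : ContinuousOn f (spectrum ℝ A)) (hg : ContinuousOn g (spectrum ℝ A)) {L : ℝ}
    (hL : 0 ≤ L) (h : ∀ x ∈ spectrum ℝ A, ‖f x‖ ≤ L * ‖g x‖) (Z : H →L[ℂ] H) :
    ‖Z * cfcC f A‖ ≤ L * ‖Z * cfcC g A‖ := by
  rw [← norm_star (Z * cfcC f A), ← norm_star (Z * cfcC g A), star_mul, star_mul, star_cfcC,
    star_cfcC]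
  exact norm_cfcC_mul_le_of_norm_le hA (by fun_prop) (by fun_prop) hL (by simpa using h) _

/-- If `a² + c² = 1` and `b² + d² = 1` with `a`, `b`, `c`, `d` self-adjoint, then
`‖a X b + c Y d‖ ≤ max ‖X‖ ‖Y‖`. -/
lemma norm_add_le_of_sq_add_sq_eq_one {a b c d X Y : H →L[ℂ] H} (ha : IsSelfAdjoint a)
    (hb : IsSelfAdjoint b) (hc : IsSelfAdjoint c) (hd : IsSelfAdjoint d)
    (hac : a * a + c * c = 1) (hbd : b * b + d * d = 1) {M : ℝ} (hX : ‖X‖ ≤ M) (hY : ‖Y‖ ≤ M) :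
    ‖a * X * b + c * Y * d‖ ≤ M := by
  have hM : 0 ≤ M := (norm_nonneg _).trans hX
  have pyth {p q : H →L[ℂ] H} (hp : IsSelfAdjoint p) (hq : IsSelfAdjoint q)
      (h : p * p + q * q = 1) (v : H) : ‖p v‖ ^ 2 + ‖q v‖ ^ 2 = ‖v‖ ^ 2 := by
    have e {p : H →L[ℂ] H} (hp : IsSelfAdjoint p) : inner ℂ (p v) (p v) = inner ℂ v ((p * p) v) := by
      rw [← ContinuousLinearMap.adjoint_inner_right, hp.adjoint_eq]; rfl
    have h2 : inner ℂ (p v) (p v) + inner ℂ (q v) (q v) = inner ℂ v v := by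
      rw [e hp, e hq, ← inner_add_right, ← _root_.add_apply, h]; rfl
    simp only [inner_self_eq_norm_sq_to_K] at h2
    exact_mod_cast h2
  refine ContinuousLinearMap.opNorm_le_of_re_inner_le hM fun v w hv hw => ?_
  have e1 : inner ℂ ((a * X * b + c * Y * d) v) w
      = inner ℂ (X (b v)) (a w) + inner ℂ (Y (d v)) (c w) := by
    rw [← ContinuousLinearMap.adjoint_inner_left a, ← ContinuousLinearMap.adjoint_inner_left c,
      ha.adjoint_eq, hc.adjoint_eq, ← inner_add_left]
    rfl
  rw [e1, map_add]
  have b1 : RCLike.re (inner ℂ (X (b v)) (a w)) ≤ M * ‖b v‖ * ‖a w‖ :=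
    (re_inner_le_norm _ _).trans (by gcongr; exact X.le_of_opNorm_le hX _)
  have b2 : RCLike.re (inner ℂ (Y (d v)) (c w)) ≤ M * ‖d v‖ * ‖c w‖ :=
    (re_inner_le_norm _ _).trans (by gcongr; exact Y.le_of_opNorm_le hY _)
  have cs : ‖b v‖ * ‖a w‖ + ‖d v‖ * ‖c w‖ ≤ ‖v‖ * ‖w‖ := by
    refine le_of_sq_le_sq ?_ (by positivity)
    rw [mul_pow, ← pyth hb hd hbd v, ← pyth ha hc hac w]
    nlinarith [sq_nonneg (‖b v‖ * ‖c w‖ - ‖d v‖ * ‖a w‖)]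
  calc _ ≤ M * (‖b v‖ * ‖a w‖ + ‖d v‖ * ‖c w‖) := by linarith
    _ ≤ M * (‖v‖ * ‖w‖) := by gcongr
    _ = M := by rw [hv, hw, mul_one, mul_one]

end FunctionalCalculus

section OperatorLipschitz

variable {H : Type} [NormedAddCommGroup H] [InnerProductSpace ℂ H] [CompleteSpace H]

lemma cfcC_exp_eq {A : H →L[ℂ] H} (hA : IsSelfAdjoint A) (t : ℝ) :
    cfcC (fun x => Complex.exp (t * x * Complex.I)) A
      = NormedSpace.exp (t • (Complex.I • A)) := by
  have := hA.isStarNormal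
  have e : t • (Complex.I • A) = cfc (fun z : ℂ => (t : ℂ) * z.re * Complex.I) A := by
    have h1 : cfcC (fun x => ((t : ℂ) * Complex.I) * x) A = t • (Complex.I • A) := by
      rw [cfcC_mul hA (by fun_prop) (by fun_prop), cfcC_const hA, cfcC_id hA, smul_mul_assoc,
        one_mul, mul_smul, Complex.coe_smul]
    rw [← h1]
    exact cfc_congr fun z _ => by ring
  have hn : IsStarNormal (t • (Complex.I • A)) := by
    rw [e]
    exact cfc_predicate _ A
  rw [← CFC.complex_exp_eq_normedSpace_exp hn, e, ← cfc_comp' _ _ A]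
  rfl

lemma norm_cfcC_exp_le {A : H →L[ℂ] H} (hA : IsSelfAdjoint A) (t : ℝ) :
    ‖cfcC (fun x => Complex.exp (t * x * Complex.I)) A‖ ≤ 1 :=
  norm_cfcC_le hA zero_le_one fun x _ => by
    rw [← Complex.ofReal_mul, Complex.norm_exp_ofReal_mul_I]

lemma norm_cfcC_exp_mul_sub_le_of_nonneg {A B : H →L[ℂ] H} (hA : IsSelfAdjoint A)
    (hB : IsSelfAdjoint B) (R : H →L[ℂ] H) {t : ℝ} (ht : 0 ≤ t) :
    ‖cfcC (fun x => Complex.exp (t * x * Complex.I)) A * R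
      - R * cfcC (fun x => Complex.exp (t * x * Complex.I)) B‖ ≤ t * ‖A * R - R * B‖ := by
  let U (s : ℝ) : H →L[ℂ] H := NormedSpace.exp (s • (Complex.I • A))
  let V (s : ℝ) : H →L[ℂ] H := NormedSpace.exp (s • (Complex.I • B))
  have hU (s : ℝ) : ‖U s‖ ≤ 1 := by
    have h := norm_cfcC_exp_le hA s
    rwa [cfcC_exp_eq hA] at h
  have hV (s : ℝ) : ‖V s‖ ≤ 1 := by
    have h := norm_cfcC_exp_le hB s
    rwa [cfcC_exp_eq hB] at h
  have dU (s : ℝ) : HasDerivAt U (U s * (Complex.I • A)) s := hasDerivAt_exp_smul_const _ s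
  have dV (s : ℝ) : HasDerivAt (fun s => V (t - s)) (-((Complex.I • B) * V (t - s))) s := by
    have h := (hasDerivAt_exp_smul_const' (𝕂 := ℝ) (Complex.I • B) (t - s)).scomp s
      ((hasDerivAt_id s).const_sub t)
    exact h.congr_deriv (by simp [V])
  have dW (s : ℝ) : HasDerivAt (fun s => U s * R * V (t - s))
      (Complex.I • (U s * (A * R - R * B) * V (t - s))) s := by
    refine (((dU s).mul_const R).mul (dV s)).congr_deriv ?_
    simp only [mul_smul_comm, smul_mul_assoc, mul_neg, ← sub_eq_add_neg, ← smul_sub]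
    congr 1
    noncomm_ring
  have key := norm_image_sub_le_of_norm_deriv_le_segment' (a := 0) (b := t)
    (f := fun s => U s * R * V (t - s)) (C := ‖A * R - R * B‖)
    (fun s _ => (dW s).hasDerivWithinAt) (fun s _ => ?_) t ⟨ht, le_rfl⟩
  · have h0 : U 0 = 1 := by simp [U]
    have h0' : V 0 = 1 := by simp [V]
    rw [cfcC_exp_eq hA, cfcC_exp_eq hB]
    simpa [h0, h0', mul_comm t] using key
  · rw [norm_smul, Complex.norm_I, one_mul]
    calc _ ≤ ‖U s‖ * ‖A * R - R * B‖ * ‖V (t - s)‖ :=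
          (norm_mul_le _ _).trans (by gcongr; exact norm_mul_le _ _)
      _ ≤ 1 * ‖A * R - R * B‖ * 1 := by gcongr <;> simp [hU, hV]
      _ = _ := by ring

lemma norm_cfcC_exp_mul_sub_le {A B : H →L[ℂ] H} (hA : IsSelfAdjoint A)
    (hB : IsSelfAdjoint B) (R : H →L[ℂ] H) (t : ℝ) :
    ‖cfcC (fun x => Complex.exp (t * x * Complex.I)) A * R
      - R * cfcC (fun x => Complex.exp (t * x * Complex.I)) B‖ ≤ |t| * ‖A * R - R * B‖ := by
  rcases le_total 0 t with ht | ht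
  · rw [abs_of_nonneg ht]
    exact norm_cfcC_exp_mul_sub_le_of_nonneg hA hB R ht
  · have h := norm_cfcC_exp_mul_sub_le_of_nonneg hA.neg hB.neg R (neg_nonneg.2 ht)
    have e {A : H →L[ℂ] H} (hA : IsSelfAdjoint A) :
        cfcC (fun x => Complex.exp ((-t : ℝ) * x * Complex.I)) (-A)
          = cfcC (fun x => Complex.exp (t * x * Complex.I)) A := by
      rw [cfcC_exp_eq hA, cfcC_exp_eq hA.neg]
      simp
    have e' : -A * R - R * -B = -(A * R - R * B) := by noncomm_ring
    rw [e hA, e hB, e', norm_neg] at h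
    rwa [abs_of_nonpos ht]

open scoped FourierTransform SchwartzMap in
/-- Schwartz functions are operator Lipschitz, uniformly under the rescalings
`t ↦ r h((t - c) / r)`. -/
lemma SchwartzMap.exists_operator_lipschitz (h : 𝓢(ℝ, ℂ)) :
    ∃ K : ℝ, 0 ≤ K ∧ ∀ (H : Type) [NormedAddCommGroup H] [InnerProductSpace ℂ H] [CompleteSpace H]
      (A B R : H →L[ℂ] H), IsSelfAdjoint A → IsSelfAdjoint B → ∀ (c r : ℝ), 0 < r →
      ‖cfcC (fun x => r * h ((x - c) / r)) A * R - R * cfcC (fun x => r * h ((x - c) / r)) B‖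
        ≤ K * ‖A * R - R * B‖ := by
  let g : 𝓢(ℝ, ℂ) := 𝓕 h
  have hg1 : Integrable (fun ξ : ℝ => ‖ξ‖ * ‖g ξ‖) := by
    simpa using g.integrable_pow_mul volume 1
  have inv (x : ℝ) : h x = ∫ ξ : ℝ, Complex.exp (2 * Real.pi * ξ * x * Complex.I) * g ξ := by
    have e : h = 𝓕⁻ g := (FourierTransform.fourierInv_fourier_eq h).symm
    rw [e, SchwartzMap.fourierInv_coe, Real.fourierInv_eq']
    refine integral_congr_ae (.of_forall fun ξ => ?_)
    simp [mul_comm, mul_left_comm, mul_assoc]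
  refine ⟨∫ ξ : ℝ, 2 * Real.pi * (‖ξ‖ * ‖g ξ‖), by positivity, ?_⟩
  intro H _ _ _ A B R hA hB c r hr
  let k (ξ : ℝ) : ℂ := r * g ξ * Complex.exp ((-(2 * Real.pi * ξ / r * c) : ℝ) * Complex.I)
  have hk (ξ : ℝ) : ‖k ξ‖ = r * ‖g ξ‖ := by
    simp only [k, norm_mul, Complex.norm_exp_ofReal_mul_I, Complex.norm_real,
      Real.norm_of_nonneg hr.le, mul_one]
  let E (T : H →L[ℂ] H) (ξ : ℝ) : H →L[ℂ] H :=
    cfcC (fun x => Complex.exp ((2 * Real.pi * ξ / r : ℝ) * x * Complex.I)) T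
  have hcont : Continuous k := by
    have := g.continuous
    fun_prop
  have repr {T : H →L[ℂ] H} (hT : IsSelfAdjoint T) :
      Integrable (fun ξ => k ξ • E T ξ) ∧
        cfcC (fun x => r * h ((x - c) / r)) T = ∫ ξ, k ξ • E T ξ := by
    have := hT.isStarNormal
    have e1 (ξ : ℝ) : k ξ • E T ξ = cfc (fun z : ℂ => k ξ *
        Complex.exp ((2 * Real.pi * ξ / r : ℝ) * z.re * Complex.I)) T := by
      have := cfcC_mul hT (f := fun _ => k ξ)
        (g := fun x => Complex.exp ((2 * Real.pi * ξ / r : ℝ) * x * Complex.I))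
        (by fun_prop) (by fun_prop)
      rw [cfcC_const hT, smul_mul_assoc, one_mul] at this
      exact this.symm
    have hb : ∀ᵐ ξ : ℝ, ∀ z ∈ spectrum ℂ T, ‖k ξ *
        Complex.exp ((2 * Real.pi * ξ / r : ℝ) * z.re * Complex.I)‖ ≤ r * ‖g ξ‖ := by
      refine .of_forall fun ξ z _ => ?_
      rw [norm_mul, hk, ← Complex.ofReal_mul, Complex.norm_exp_ofReal_mul_I, mul_one]
    have hfin : HasFiniteIntegral (fun ξ : ℝ => r * ‖g ξ‖) volume :=
      (g.integrable.norm.const_mul r).2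
    have hc : ContinuousOn (Function.uncurry fun (ξ : ℝ) (z : ℂ) => k ξ *
        Complex.exp ((2 * Real.pi * ξ / r : ℝ) * z.re * Complex.I))
        (Set.univ ×ˢ spectrum ℂ T) := by
      refine Continuous.continuousOn ?_
      unfold Function.uncurry
      fun_prop
    simp only [e1]
    refine ⟨integrable_cfc _ _ T hc hb hfin, ?_⟩
    rw [← cfc_integral _ _ T hc hb hfin]
    refine cfc_congr fun z _ => ?_
    simp only
    rw [inv, ← integral_const_mul]
    refine integral_congr_ae (.of_forall fun ξ => ?_)
    simp only [k]
    rw [mul_assoc (r * g ξ : ℂ), ← Complex.exp_add, mul_comm (Complex.exp _) (g ξ), ← mul_assoc]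
    congr 2
    have : (r : ℂ) ≠ 0 := by exact_mod_cast hr.ne'
    push_cast
    field_simp
    ring
  obtain ⟨iA, eA⟩ := repr hA
  obtain ⟨iB, eB⟩ := repr hB
  have iA' : Integrable (fun ξ => k ξ • E A ξ * R) :=
    ((ContinuousLinearMap.mul ℂ (H →L[ℂ] H)).flip R).integrable_comp iA
  have iB' : Integrable (fun ξ => R * k ξ • E B ξ) :=
    ((ContinuousLinearMap.mul ℂ (H →L[ℂ] H)) R).integrable_comp iB
  have eA' : (∫ ξ, k ξ • E A ξ) * R = ∫ ξ, k ξ • E A ξ * R :=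
    (((ContinuousLinearMap.mul ℂ (H →L[ℂ] H)).flip R).integral_comp_comm iA).symm
  have eB' : R * (∫ ξ, k ξ • E B ξ) = ∫ ξ, R * k ξ • E B ξ :=
    (((ContinuousLinearMap.mul ℂ (H →L[ℂ] H)) R).integral_comp_comm iB).symm
  rw [eA, eB, eA', eB', ← integral_sub iA' iB', ← integral_mul_const]
  refine norm_integral_le_of_norm_le ((hg1.const_mul _).mul_const _) (.of_forall fun ξ => ?_)
  rw [mul_smul_comm, smul_mul_assoc, ← smul_sub, norm_smul, hk]
  calc r * ‖g ξ‖ * ‖E A ξ * R - R * E B ξ‖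
      ≤ r * ‖g ξ‖ * (|2 * Real.pi * ξ / r| * ‖A * R - R * B‖) := by
        gcongr
        exact norm_cfcC_exp_mul_sub_le hA hB R _
    _ = _ := by
        rw [abs_div, abs_of_pos hr, abs_mul, abs_of_pos Real.two_pi_pos, Real.norm_eq_abs]
        field_simp

end OperatorLipschitz

section Cutoff

/-- A smooth partition `χ² + ψ² = 1` with `χ` supported in `[-2, 2]` and `ψ` vanishing on `[-1, 1]`,
such that `t χ(t)` and `t (1 - ψ(t))` are restrictions of Schwartz functions. -/
lemma exists_schwartz_partition :
    ∃ (χ ψ : ℝ → ℝ) (h₁ h₂ : SchwartzMap ℝ ℂ), Continuous χ ∧ Continuous ψ ∧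
      (∀ t, χ t ^ 2 + ψ t ^ 2 = 1) ∧ (∀ t, 2 ≤ |t| → χ t = 0) ∧ (∀ t, |t| ≤ 1 → ψ t = 0) ∧
      (∀ t, h₁ t = t * χ t) ∧ (∀ t, h₂ t = t * (1 - ψ t)) := by
  let b : ContDiffBump (0 : ℝ) := ⟨1, 2, one_pos, one_lt_two⟩
  let θ : ℝ → ℝ := fun t => Real.pi / 2 * b t
  have hθ : ContDiff ℝ ((⊤ : ℕ∞) : WithTop ℕ∞) θ := contDiff_const.mul b.contDiff
  have hθ_out {t : ℝ} (ht : 2 ≤ |t|) : θ t = 0 := by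
    have : b t = 0 := b.zero_of_le_dist (by simpa using ht)
    simp [θ, this]
  have hθ_in {t : ℝ} (ht : |t| ≤ 1) : θ t = Real.pi / 2 := by
    have : b t = 1 := b.one_of_mem_closedBall (by simpa using ht)
    simp [θ, this]
  have compact {u : ℝ → ℂ} (hu : ∀ t, 2 ≤ |t| → u t = 0) : HasCompactSupport u :=
    HasCompactSupport.intro (isCompact_closedBall (0 : ℝ) 2) fun t ht => hu t (by
      rw [Metric.mem_closedBall, dist_zero_right, Real.norm_eq_abs, not_le] at ht
      exact ht.le)
  have d₁ : ContDiff ℝ ((⊤ : ℕ∞) : WithTop ℕ∞) fun t : ℝ => (t : ℂ) * (Real.sin (θ t) : ℂ) :=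
    Complex.ofRealCLM.contDiff.mul (Complex.ofRealCLM.contDiff.comp hθ.sin)
  have d₂ : ContDiff ℝ ((⊤ : ℕ∞) : WithTop ℕ∞) fun t : ℝ => (t : ℂ) * (1 - (Real.cos (θ t) : ℂ)) :=
    Complex.ofRealCLM.contDiff.mul
      (contDiff_const.sub (Complex.ofRealCLM.contDiff.comp hθ.cos))
  have s₁ : HasCompactSupport fun t : ℝ => (t : ℂ) * (Real.sin (θ t) : ℂ) :=
    compact fun t ht => by simp [hθ_out ht]
  have s₂ : HasCompactSupport fun t : ℝ => (t : ℂ) * (1 - (Real.cos (θ t) : ℂ)) :=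
    compact fun t ht => by simp [hθ_out ht]
  exact ⟨fun t => Real.sin (θ t), fun t => Real.cos (θ t), s₁.toSchwartzMap d₁,
    s₂.toSchwartzMap d₂, Real.continuous_sin.comp hθ.continuous,
    Real.continuous_cos.comp hθ.continuous, fun t => Real.sin_sq_add_cos_sq _,
    fun t ht => by simp [hθ_out ht], fun t ht => by simp [hθ_in ht], fun _ => rfl, fun _ => rfl⟩

/-- A finite set of reals splits off a cluster: for some centre `c` in the set and radius `r`, a
fixed proportion of the points lies in `[c - r, c + r]` and a fixed proportion lies outside
`(c - 2 * r, c + 2 * r)`. -/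
lemma Finset.exists_cluster (X : Finset ℝ) (hX : 8 ≤ X.card) :
    ∃ c ∈ X, ∃ r : ℝ, 0 < r ∧ 8 * (X.filter fun x => |x - c| < 2 * r).card ≤ 7 * X.card ∧
      8 * (X.filter fun x => r < |x - c|).card ≤ 7 * X.card := by
  set m := X.card / 8 + 1 with hm
  let P := (X ×ˢ X).filter fun p => m ≤ (X.filter fun x => |x - p.1| ≤ |p.2 - p.1|).card
  have hne : X.Nonempty := Finset.card_pos.1 (by omega)
  obtain ⟨p₀, hp₀⟩ := hne
  have hP : P.Nonempty := by
    obtain ⟨q, hq, hmax⟩ := X.exists_max_image (fun x => |x - p₀|) ⟨p₀, hp₀⟩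
    refine ⟨(p₀, q), ?_⟩
    simp only [P, Finset.mem_filter, Finset.mem_product]
    refine ⟨⟨hp₀, hq⟩, ?_⟩
    rw [Finset.filter_true_of_mem hmax]
    omega
  obtain ⟨⟨c, c'⟩, hc, hmin⟩ := P.exists_min_image (fun p => |p.2 - p.1|) hP
  simp only [P, Finset.mem_filter, Finset.mem_product] at hc hmin
  obtain ⟨⟨hcX, hcX'⟩, hcard⟩ := hc
  set r := |c' - c| with hr
  have hr0 : 0 < r := by
    by_contra h0
    have h0 : r = 0 := le_antisymm (not_lt.1 h0) (abs_nonneg _)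
    have : (X.filter fun x => |x - c| ≤ r) ⊆ {c} := fun x hx => by
      rw [Finset.mem_filter, h0] at hx
      rw [Finset.mem_singleton]
      linarith [abs_nonpos_iff.1 hx.2]
    have := Finset.card_le_card this
    simp only [Finset.card_singleton] at this
    omega
  have short (a : ℝ) : (X.filter fun x => a ≤ x ∧ x < a + r).card ≤ X.card / 8 := by
    by_contra hlt
    have hm' : m ≤ (X.filter fun x => a ≤ x ∧ x < a + r).card := by omega
    obtain ⟨p, hp, hpmin⟩ := Finset.exists_min_image (X.filter fun x => a ≤ x ∧ x < a + r) id
      (Finset.card_pos.1 (by omega))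
    obtain ⟨q, hq, hqmax⟩ := Finset.exists_max_image (X.filter fun x => a ≤ x ∧ x < a + r) id
      (Finset.card_pos.1 (by omega))
    have hpq : |q - p| < r := by
      have := hpmin q hq
      rw [Finset.mem_filter] at hp hq
      rw [abs_lt]
      simp only [id] at this
      constructor <;> linarith [hp.2.1, hq.2.2]
    have hle := hmin (p, q) ⟨⟨(Finset.mem_filter.1 hp).1, (Finset.mem_filter.1 hq).1⟩,
      hm'.trans (Finset.card_le_card fun x hx => by
        have h1 := hpmin x hx
        have h2 := hqmax x hx
        simp only [id] at h1 h2
        rw [Finset.mem_filter] at hx ⊢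
        refine ⟨hx.1, ?_⟩
        rw [abs_of_nonneg (by linarith), abs_of_nonneg (by linarith)]
        linarith)⟩
    simp only at hle
    linarith
  refine ⟨c, hcX, r, hr0, ?_, ?_⟩
  · have hcover : (X.filter fun x => |x - c| < 2 * r) ⊆
        ((X.filter fun x => c - 2 * r ≤ x ∧ x < c - 2 * r + r) ∪
          (X.filter fun x => c - r ≤ x ∧ x < c - r + r)) ∪
        ((X.filter fun x => c ≤ x ∧ x < c + r) ∪
          (X.filter fun x => c + r ≤ x ∧ x < c + r + r)) := by
      intro x hx
      simp only [Finset.mem_filter, Finset.mem_union, abs_lt] at hx ⊢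
      obtain ⟨hxX, h1, h2⟩ := hx
      simp only [hxX, true_and]
      rcases lt_or_ge x (c - r) with h3 | h3
      · exact Or.inl (Or.inl ⟨by linarith, by linarith⟩)
      rcases lt_or_ge x c with h4 | h4
      · exact Or.inl (Or.inr ⟨by linarith, by linarith⟩)
      rcases lt_or_ge x (c + r) with h5 | h5
      · exact Or.inr (Or.inl ⟨by linarith, by linarith⟩)
      · exact Or.inr (Or.inr ⟨by linarith, by linarith⟩)
    have h := (Finset.card_le_card hcover).trans
      ((Finset.card_union_le _ _).trans
        (Nat.add_le_add (Finset.card_union_le _ _) (Finset.card_union_le _ _)))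
    have := short (c - 2 * r)
    have := short (c - r)
    have := short c
    have := short (c + r)
    omega
  · have h := X.card_filter_add_card_filter_not (fun x => |x - c| ≤ r)
    simp only [not_le] at h
    omega

end Cutoff

section FiniteSpectrum

variable {H : Type} [NormedAddCommGroup H] [InnerProductSpace ℂ H] [CompleteSpace H]

/-- The commutator estimate for a cutoff `η` concentrated near `c`: the double commutator with `η`
makes `f(A) R - R f(B)` controllable by a multiple of the Lipschitz constant. -/
lemma norm_double_commutator_le {A B : H →L[ℂ] H} (hA : IsSelfAdjoint A) (hB : IsSelfAdjoint B)
    (R : H →L[ℂ] H) {f η : ℝ → ℂ} (hf : Continuous f) (hη : Continuous η) (hη2 : ∀ x, ‖η x‖ ≤ 2)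
    {L K c : ℝ} (hL : 0 ≤ L) (hK0 : 0 ≤ K)
    (hfA : ∀ x ∈ spectrum ℝ A, ‖f x - f c‖ ≤ L * |x - c|)
    (hfB : ∀ x ∈ spectrum ℝ B, ‖f x - f c‖ ≤ L * |x - c|)
    (hK : ∀ W : H →L[ℂ] H, ‖cfcC (fun x => (x - c) * η x) A * W
      - W * cfcC (fun x => (x - c) * η x) B‖ ≤ K * ‖A * W - W * B‖) {T : H →L[ℂ] H}
    (hT : T = cfcC f A * R - R * cfcC f B) :
    ‖cfcC η A * (cfcC η A * T - T * cfcC η B) - (cfcC η A * T - T * cfcC η B) * cfcC η B‖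
      ≤ (8 * K + 32) * L * ‖A * R - R * B‖ := by
  set a := cfcC η A with ha
  set b := cfcC η B with hb
  set D := A * R - R * B with hD
  have na : ‖a‖ ≤ 2 := norm_cfcC_le hA zero_le_two fun x _ => hη2 x
  have nb : ‖b‖ ≤ 2 := norm_cfcC_le hB zero_le_two fun x _ => hη2 x
  have comm_le (S : H →L[ℂ] H) : ‖a * S - S * b‖ ≤ 4 * ‖S‖ := by
    calc ‖a * S - S * b‖ ≤ ‖a‖ * ‖S‖ + ‖S‖ * ‖b‖ :=
          (norm_sub_le _ _).trans (add_le_add (norm_mul_le _ _) (norm_mul_le _ _))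
      _ ≤ 2 * ‖S‖ + ‖S‖ * 2 := by gcongr
      _ = 4 * ‖S‖ := by ring
  have comm_id {C : H →L[ℂ] H} (hC : IsSelfAdjoint C) : C * cfcC η C = cfcC η C * C := by
    have := cfcC_commute (fun x => (x : ℂ)) η C
    rwa [cfcC_id hC] at this
  have sub_c {C : H →L[ℂ] H} (hC : IsSelfAdjoint C) :
      cfcC (fun x => (x : ℂ) - c) C = C - (c : ℂ) • 1 := by
    rw [cfcC_sub hC (by fun_prop) (by fun_prop), cfcC_id hC, cfcC_const hC]
  have f_sub_c {C : H →L[ℂ] H} (hC : IsSelfAdjoint C) :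
      cfcC (fun x => f x - f c) C = cfcC f C - f c • 1 := by
    rw [cfcC_sub hC (by fun_prop) (by fun_prop), cfcC_const hC]
  set W := a * R - R * b with hW
  set Z := a * W - W * b with hZ
  have hD1 : A * W - W * B = a * D - D * b := by
    rw [hW, hD]
    simp only [mul_sub, sub_mul, ← mul_assoc, comm_id hA, ha]
    simp only [mul_assoc, comm_id hB, hb]
    abel
  have hD2 : A * Z - Z * B = a * (A * W - W * B) - (A * W - W * B) * b := by
    rw [hZ]
    simp only [mul_sub, sub_mul, ← mul_assoc, comm_id hA, ha]
    simp only [mul_assoc, comm_id hB, hb]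
    abel
  have n1 : ‖A * W - W * B‖ ≤ 4 * ‖D‖ := hD1 ▸ comm_le D
  have n2 : ‖A * Z - Z * B‖ ≤ 16 * ‖D‖ := by
    rw [hD2]
    linarith [comm_le (A * W - W * B)]
  have hAZ : cfcC (fun x => (x : ℂ) - c) A * Z = (cfcC (fun x => (x - c) * η x) A * W
      - W * cfcC (fun x => (x - c) * η x) B) - (A * W - W * B) * b := by
    rw [cfcC_mul hA (by fun_prop) (by fun_prop), cfcC_mul hB (by fun_prop) (by fun_prop),
      sub_c hA, sub_c hB, hZ, ← ha, ← hb]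
    simp only [mul_sub, sub_mul, smul_mul_assoc, mul_smul_comm, one_mul, mul_assoc]
    abel
  have hZB : Z * cfcC (fun x => (x : ℂ) - c) B
      = cfcC (fun x => (x : ℂ) - c) A * Z - (A * Z - Z * B) := by
    rw [sub_c hA, sub_c hB]
    simp only [mul_sub, sub_mul, smul_mul_assoc, mul_smul_comm, one_mul, mul_one]
    abel
  have n3 : ‖cfcC (fun x => (x : ℂ) - c) A * Z‖ ≤ (4 * K + 8) * ‖D‖ := by
    rw [hAZ]
    calc _ ≤ K * ‖A * W - W * B‖ + ‖A * W - W * B‖ * ‖b‖ :=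
          (norm_sub_le _ _).trans (add_le_add (hK W) (norm_mul_le _ _))
      _ ≤ K * (4 * ‖D‖) + (4 * ‖D‖) * 2 := by gcongr
      _ = _ := by ring
  have n4 : ‖Z * cfcC (fun x => (x : ℂ) - c) B‖ ≤ (4 * K + 24) * ‖D‖ := by
    rw [hZB]
    linarith [norm_sub_le (cfcC (fun x => (x : ℂ) - c) A * Z) (A * Z - Z * B)]
  have key : a * (a * T - T * b) - (a * T - T * b) * b
      = cfcC (fun x => f x - f c) A * Z - Z * cfcC (fun x => f x - f c) B := by
    rw [f_sub_c hA, f_sub_c hB, hZ, hW, hT]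
    have ca : cfcC f A * a = a * cfcC f A := cfcC_commute _ _ _
    have cb : cfcC f B * b = b * cfcC f B := cfcC_commute _ _ _
    simp only [mul_sub, sub_mul, smul_mul_assoc, mul_smul_comm, one_mul, mul_one, smul_sub,
      ← mul_assoc, ca]
    simp only [mul_assoc, cb, ca]
    abel
  have norm_eq (x : ℝ) : ‖(x : ℂ) - c‖ = |x - c| := by
    rw [← Complex.ofReal_sub, Complex.norm_real, Real.norm_eq_abs]
  have n5 := norm_cfcC_mul_le_of_norm_le hA (f := fun x => f x - f c)
    (g := fun x => (x : ℂ) - c) (by fun_prop) (by fun_prop) hL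
    (fun x hx => by rw [norm_eq]; exact hfA x hx) Z
  have n6 := norm_mul_cfcC_le_of_norm_le hB (f := fun x => f x - f c)
    (g := fun x => (x : ℂ) - c) (by fun_prop) (by fun_prop) hL
    (fun x hx => by rw [norm_eq]; exact hfB x hx) Z
  rw [key]
  calc _ ≤ L * ((4 * K + 8) * ‖D‖) + L * ((4 * K + 24) * ‖D‖) :=
        (norm_sub_le _ _).trans (add_le_add (n5.trans (by gcongr)) (n6.trans (by gcongr)))
    _ = _ := by ring

/-- The spectral projection of `A` for the set `s` (meaningful when the spectrum is finite). -/
noncomputable def finiteSpectralProj (A : H →L[ℂ] H) (s : Set ℝ) : H →L[ℂ] H :=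
  cfcC (s.indicator fun _ => (1 : ℂ)) A

lemma norm_finiteSpectralProj_le {A : H →L[ℂ] H} (hA : IsSelfAdjoint A) (s : Set ℝ) :
    ‖finiteSpectralProj A s‖ ≤ 1 :=
  norm_cfcC_le hA zero_le_one fun x _ => by
    by_cases hx : x ∈ s <;> simp [hx]

lemma cfcC_mul_finiteSpectralProj_eq {A : H →L[ℂ] H} (hA : IsSelfAdjoint A)
    (hfin : (spectrum ℝ A).Finite) {f g : ℝ → ℂ} {s t : Set ℝ}
    (h : ∀ x, f x * s.indicator (fun _ => (1 : ℂ)) x = g x * t.indicator (fun _ => (1 : ℂ)) x) :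
    cfcC f A * finiteSpectralProj A s = cfcC g A * finiteSpectralProj A t := by
  rw [finiteSpectralProj, finiteSpectralProj, ← cfcC_mul hA (hfin.continuousOn _)
    (hfin.continuousOn _), ← cfcC_mul hA (hfin.continuousOn _) (hfin.continuousOn _)]
  exact cfcC_congr hA fun x _ => h x

lemma finiteSpectralProj_insert {A : H →L[ℂ] H} (hA : IsSelfAdjoint A)
    (hfin : (spectrum ℝ A).Finite) {s : Set ℝ} {x : ℝ} (hx : x ∉ s) :
    finiteSpectralProj A (insert x s) = finiteSpectralProj A {x} + finiteSpectralProj A s := by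
  rw [finiteSpectralProj, finiteSpectralProj, finiteSpectralProj,
    ← cfcC_add hA (hfin.continuousOn _) (hfin.continuousOn _)]
  refine cfcC_congr hA fun y _ => ?_
  by_cases hy : y = x
  · simp [hy, hx]
  · by_cases hs : y ∈ s <;> simp [hy, hs]

lemma norm_finiteSpectralProj_singleton_mul_le {A B : H →L[ℂ] H} (hA : IsSelfAdjoint A)
    (hB : IsSelfAdjoint B) (hfin : (spectrum ℝ A).Finite) (R : H →L[ℂ] H) {f : ℝ → ℂ}
    (hf : Continuous f) {L x : ℝ} (hL : 0 ≤ L)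
    (hfB : ∀ y ∈ spectrum ℝ B, ‖f y - f x‖ ≤ L * |y - x|) :
    ‖finiteSpectralProj A {x} * (cfcC f A * R - R * cfcC f B)‖ ≤ L * ‖A * R - R * B‖ := by
  set P := finiteSpectralProj A {x} with hP
  have hg {g : ℝ → ℂ} (hg : Continuous g) : P * (cfcC g A * R - R * cfcC g B)
      = -(P * R * cfcC (fun y => g y - g x) B) := by
    have h1 : P * cfcC g A = g x • P := by
      have h2 := cfcC_mul_finiteSpectralProj_eq hA hfin (f := g) (g := fun _ => g x)
        (s := {x}) (t := {x}) fun y => by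
          by_cases hy : y = x <;> simp [hy]
      rw [cfcC_const hA, smul_mul_assoc, one_mul] at h2
      rw [← h2, hP, finiteSpectralProj, cfcC_commute]
    rw [cfcC_sub hB (by fun_prop) (by fun_prop), cfcC_const hB, mul_sub, ← mul_assoc, h1]
    simp only [mul_sub, smul_mul_assoc, mul_smul_comm, mul_one, mul_assoc]
    abel
  have h1 := hg (g := fun y => (y : ℂ)) (by fun_prop)
  rw [cfcC_id hA, cfcC_id hB] at h1
  rw [hg hf, norm_neg]
  calc _ ≤ L * ‖P * R * cfcC (fun y => (y : ℂ) - x) B‖ :=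
        norm_mul_cfcC_le_of_norm_le hB (by fun_prop) (by fun_prop) hL (fun y hy => by
          rw [← Complex.ofReal_sub, Complex.norm_real, Real.norm_eq_abs]
          exact hfB y hy) _
    _ = L * ‖P * (A * R - R * B)‖ := by rw [h1, norm_neg]
    _ ≤ L * (1 * ‖A * R - R * B‖) := by
        gcongr
        exact (norm_mul_le _ _).trans (by gcongr; exact norm_finiteSpectralProj_le hA _)
    _ = _ := by rw [one_mul]

lemma norm_finiteSpectralProj_mul_le_card {A B : H →L[ℂ] H} (hA : IsSelfAdjoint A)
    (hB : IsSelfAdjoint B) (hfin : (spectrum ℝ A).Finite) (R : H →L[ℂ] H) {f : ℝ → ℂ}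
    (hf : Continuous f) {L : ℝ} (hL : 0 ≤ L) (X : Finset ℝ)
    (hfB : ∀ x ∈ X, ∀ y ∈ spectrum ℝ B, ‖f y - f x‖ ≤ L * |y - x|) :
    ‖finiteSpectralProj A X * (cfcC f A * R - R * cfcC f B)‖
      ≤ X.card * (L * ‖A * R - R * B‖) := by
  induction X using Finset.induction with
  | empty =>
    have h0 : finiteSpectralProj A (∅ : Set ℝ) = 0 := by
      rw [finiteSpectralProj, cfcC_congr hA (g := fun _ => 0) (by simp), cfcC_const hA, zero_smul]
    simp [h0]
  | insert x X hx ih =>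
    rw [Finset.coe_insert, finiteSpectralProj_insert hA hfin (by simpa using hx), add_mul,
      Finset.card_insert_of_notMem hx]
    have h1 := norm_finiteSpectralProj_singleton_mul_le hA hB hfin R hf hL
      (hfB x (Finset.mem_insert_self _ _))
    have h2 := ih fun y hy => hfB y (Finset.mem_insert_of_mem hy)
    push_cast
    linarith [norm_add_le (finiteSpectralProj A {x} * (cfcC f A * R - R * cfcC f B))
      (finiteSpectralProj A X * (cfcC f A * R - R * cfcC f B))]

end FiniteSpectrum

/-- There is a constant `M` such that the norm of a spectral compression of `f(A) R - R f(B)` to a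
finite set `X` with at least eight points exceeds those for the two pieces of a cluster
decomposition of `X` by at most `M L ‖A R - R B‖`. -/
lemma exists_norm_finiteSpectralProj_mul_le :
    ∃ M : ℝ, 0 ≤ M ∧ ∀ (H : Type) [NormedAddCommGroup H] [InnerProductSpace ℂ H] [CompleteSpace H]
      (A B R : H →L[ℂ] H), IsSelfAdjoint A → IsSelfAdjoint B → (spectrum ℝ A).Finite →
      ∀ (f : ℝ → ℂ) (L c r V : ℝ), Continuous f → 0 ≤ L → 0 < r →
        (∀ x ∈ spectrum ℝ A, ‖f x - f c‖ ≤ L * |x - c|) →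
        (∀ x ∈ spectrum ℝ B, ‖f x - f c‖ ≤ L * |x - c|) →
        ∀ X : Finset ℝ,
        ‖finiteSpectralProj A (X.filter fun x => |x - c| < 2 * r)
          * (cfcC f A * R - R * cfcC f B)‖ ≤ V →
        ‖finiteSpectralProj A (X.filter fun x => r < |x - c|)
          * (cfcC f A * R - R * cfcC f B)‖ ≤ V →
        ‖finiteSpectralProj A X * (cfcC f A * R - R * cfcC f B)‖
          ≤ V + M * (L * ‖A * R - R * B‖) := by
  obtain ⟨χ, ψ, h₁, h₂, hχc, hψc, hsq, hχ0, hψ0, hh₁, hh₂⟩ := exists_schwartz_partition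
  obtain ⟨K₁, hK₁0, hK₁⟩ := h₁.exists_operator_lipschitz
  obtain ⟨K₂, hK₂0, hK₂⟩ := h₂.exists_operator_lipschitz
  refine ⟨((8 * K₁ + 32) + (8 * K₂ + 32)) / 2, by positivity, ?_⟩
  intro H _ _ _ A B R hA hB hfin f L c r V hf hL hr hfA hfB X hV₁ hV₂
  set T := cfcC f A * R - R * cfcC f B with hT
  let u : ℝ → ℂ := fun x => χ ((x - c) / r)
  let v : ℝ → ℂ := fun x => ψ ((x - c) / r)
  have hu : Continuous u := by fun_prop
  have hv : Continuous v := by fun_prop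
  have huv (x : ℝ) : u x * u x + v x * v x = 1 := by
    have := hsq ((x - c) / r)
    simp only [u, v, ← sq]
    exact_mod_cast this
  have hu1 (x : ℝ) : ‖u x‖ ≤ 1 := by
    rw [Complex.norm_real, Real.norm_eq_abs, abs_le_one_iff_mul_self_le_one]
    nlinarith [hsq ((x - c) / r), sq_nonneg (ψ ((x - c) / r))]
  have hv1 (x : ℝ) : ‖v x‖ ≤ 1 := by
    rw [Complex.norm_real, Real.norm_eq_abs, abs_le_one_iff_mul_self_le_one]
    nlinarith [hsq ((x - c) / r), sq_nonneg (χ ((x - c) / r))]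
  have sa {C : H →L[ℂ] H} (w : ℝ → ℝ) : IsSelfAdjoint (cfcC (fun x => (w x : ℂ)) C) := by
    rw [IsSelfAdjoint, star_cfcC]
    simp
  have sum_one {C : H →L[ℂ] H} (hC : IsSelfAdjoint C) :
      cfcC u C * cfcC u C + cfcC v C * cfcC v C = 1 := by
    rw [← cfcC_mul hC (by fun_prop) (by fun_prop), ← cfcC_mul hC (by fun_prop) (by fun_prop),
      ← cfcC_add hC (by fun_prop) (by fun_prop), cfcC_congr hC fun x _ => huv x, cfcC_const hC,
      one_smul]
  have one_sub {C : H →L[ℂ] H} (hC : IsSelfAdjoint C) :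
      cfcC (fun x => 1 - v x) C = 1 - cfcC v C := by
    rw [cfcC_sub hC (by fun_prop) (by fun_prop), cfcC_const hC, one_smul]
  have hr' : (r : ℂ) ≠ 0 := by exact_mod_cast hr.ne'
  have e₁ : (fun x : ℝ => (x - c : ℂ) * u x) = fun x => r * h₁ ((x - c) / r) := by
    funext x
    rw [hh₁]
    push_cast
    field_simp
    simp [u]
  have e₂ : (fun x : ℝ => (x - c : ℂ) * (1 - v x)) = fun x => r * h₂ ((x - c) / r) := by
    funext x
    rw [hh₂]
    push_cast
    field_simp
    simp [v]
  have b₁ := norm_double_commutator_le hA hB R hf hu (fun x => (hu1 x).trans one_le_two) hL hK₁0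
    hfA hfB (fun W => by rw [e₁]; exact hK₁ H A B W hA hB c r hr) hT
  have b₂ := norm_double_commutator_le hA hB R hf (η := fun x => 1 - v x) (by fun_prop)
    (fun x => (norm_sub_le _ _).trans (by rw [norm_one]; linarith [hv1 x])) hL hK₂0
    hfA hfB (fun W => by rw [e₂]; exact hK₂ H A B W hA hB c r hr) hT
  rw [one_sub hA, one_sub hB] at b₂
  set a := cfcC u A with ha
  set b := cfcC u B with hb
  set a' := cfcC v A with ha'
  set b' := cfcC v B with hb'
  set P := finiteSpectralProj A X with hP
  set S₁ := a * (a * T - T * b) - (a * T - T * b) * b with hS₁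
  set S₂ := (1 - a') * ((1 - a') * T - T * (1 - b')) - ((1 - a') * T - T * (1 - b')) * (1 - b')
    with hS₂
  have cut₁ : a * P = a * finiteSpectralProj A (X.filter fun x => |x - c| < 2 * r) :=
    cfcC_mul_finiteSpectralProj_eq hA hfin fun x => by
      by_cases hx : |x - c| < 2 * r
      · by_cases hxX : x ∈ X <;> simp [hx, hxX]
      · have : χ ((x - c) / r) = 0 := hχ0 _ (by
          rw [abs_div, abs_of_pos hr, le_div_iff₀ hr]
          exact not_lt.1 hx)
        simp [u, this]
  have cut₂ : a' * P = a' * finiteSpectralProj A (X.filter fun x => r < |x - c|) :=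
    cfcC_mul_finiteSpectralProj_eq hA hfin fun x => by
      by_cases hx : r < |x - c|
      · by_cases hxX : x ∈ X <;> simp [hx, hxX]
      · have : ψ ((x - c) / r) = 0 := hψ0 _ (by
          rw [abs_div, abs_of_pos hr, div_le_one hr]
          exact not_lt.1 hx)
        simp [v, this]
  have hS : S₁ + S₂ = (2 : ℂ) • (T - (a * T * b + a' * T * b')) := by
    have h1 : S₁ + S₂ = (a * a + a' * a') * T + T * (b * b + b' * b')
        - (2 : ℂ) • (a * T * b + a' * T * b') := by
      rw [hS₁, hS₂, two_smul]
      noncomm_ring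
    rw [h1, sum_one hA, sum_one hB, one_mul, mul_one, smul_sub, two_smul ℂ T]
  have split : P * T = (a * (P * T) * b + a' * (P * T) * b')
      + (1 / 2 : ℂ) • (P * (S₁ + S₂)) := by
    have ca : a * P = P * a := cfcC_commute _ _ _
    have ca' : a' * P = P * a' := cfcC_commute _ _ _
    rw [hS, mul_smul_comm, smul_smul, ← mul_assoc a, ← mul_assoc a', ca, ca']
    norm_num
    noncomm_ring
  have main : ‖a * (P * T) * b + a' * (P * T) * b'‖ ≤ V := by
    rw [← mul_assoc a, ← mul_assoc a', cut₁, cut₂, mul_assoc a, mul_assoc a']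
    exact norm_add_le_of_sq_add_sq_eq_one (sa _) (sa _) (sa _) (sa _) (sum_one hA) (sum_one hB)
      hV₁ hV₂
  have err : ‖P * (S₁ + S₂)‖ ≤ 1 * (‖S₁‖ + ‖S₂‖) :=
    (norm_mul_le _ _).trans
      (mul_le_mul (norm_finiteSpectralProj_le hA _) (norm_add_le _ _) (norm_nonneg _) zero_le_one)
  rw [split]
  refine (norm_add_le _ _).trans ?_
  rw [norm_smul]
  have : ‖(1 / 2 : ℂ)‖ = 1 / 2 := by norm_num
  rw [this]
  linarith

lemma exists_norm_finiteSpectralProj_mul_le_log :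
    ∃ C : ℝ, 0 < C ∧ ∀ (H : Type) [NormedAddCommGroup H] [InnerProductSpace ℂ H] [CompleteSpace H]
      (A B R : H →L[ℂ] H), IsSelfAdjoint A → IsSelfAdjoint B → (spectrum ℝ A).Finite →
      ∀ (f : ℝ → ℂ) (L : ℝ), Continuous f → 0 ≤ L →
        (∀ x ∈ spectrum ℝ A ∪ spectrum ℝ B, ∀ y ∈ spectrum ℝ A ∪ spectrum ℝ B,
          ‖f x - f y‖ ≤ L * |x - y|) →
        ∀ X : Finset ℝ, (X : Set ℝ) ⊆ spectrum ℝ A →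
        ‖finiteSpectralProj A X * (cfcC f A * R - R * cfcC f B)‖
          ≤ C * (1 + Real.log X.card) * (L * ‖A * R - R * B‖) := by
  obtain ⟨M, hM0, hM⟩ := exists_norm_finiteSpectralProj_mul_le
  have hlog : 0 < Real.log (8 / 7) := Real.log_pos (by norm_num)
  set C := 8 + M / Real.log (8 / 7) with hC
  have hC8 : 8 ≤ C := by rw [hC]; linarith [div_nonneg hM0 hlog.le]
  have hCM : M ≤ C * Real.log (8 / 7) := by
    rw [hC, add_mul, div_mul_cancel₀ _ hlog.ne']
    linarith
  refine ⟨C, by linarith, ?_⟩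
  intro H _ _ _ A B R hA hB hfin f L hf hL hlip X
  induction X using Finset.strongInduction with
  | H X ih =>
    intro hX
    have hD : 0 ≤ L * ‖A * R - R * B‖ := by positivity
    have hlogX : 0 ≤ Real.log X.card := Real.log_natCast_nonneg _
    rcases lt_or_ge X.card 8 with h8 | h8
    · refine (norm_finiteSpectralProj_mul_le_card hA hB hfin R hf hL X fun x hx y hy =>
        hlip y (Or.inr hy) x (Or.inl (hX hx))).trans ?_
      gcongr
      have : (X.card : ℝ) ≤ 8 := by exact_mod_cast h8.le
      nlinarith
    · obtain ⟨c, hc, r, hr, hX₁, hX₂⟩ := X.exists_cluster h8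
      have hcard : (8 : ℝ) ≤ X.card := by exact_mod_cast h8
      have hsmall (Y : Finset ℝ) (hY : Y ⊆ X) (hYc : 8 * Y.card ≤ 7 * X.card) :
          ‖finiteSpectralProj A Y * (cfcC f A * R - R * cfcC f B)‖
            ≤ C * (1 + Real.log (7 / 8 * X.card)) * (L * ‖A * R - R * B‖) := by
        have hne : Y ≠ X := by
          rintro rfl
          omega
        refine (ih Y (Finset.ssubset_iff_subset_ne.2 ⟨hY, hne⟩)
          ((Finset.coe_subset.2 hY).trans hX)).trans ?_
        have hle : Real.log Y.card ≤ Real.log (7 / 8 * X.card) := by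
          rcases Nat.eq_zero_or_pos Y.card with h0 | h0
          · rw [h0, Nat.cast_zero, Real.log_zero]
            exact Real.log_nonneg (by linarith)
          · refine Real.log_le_log (by exact_mod_cast h0) ?_
            have : (8 : ℝ) * Y.card ≤ 7 * X.card := by exact_mod_cast hYc
            linarith
        gcongr
      have hcA : c ∈ spectrum ℝ A := hX hc
      refine (hM H A B R hA hB hfin f L c r _ hf hL hr (fun x hx => hlip x (Or.inl hx) c (Or.inl hcA))
        (fun x hx => hlip x (Or.inr hx) c (Or.inl hcA)) X
        (hsmall _ (Finset.filter_subset _ _) hX₁) (hsmall _ (Finset.filter_subset _ _) hX₂)).trans ?_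
      have hl : Real.log (7 / 8 * X.card) = Real.log X.card - Real.log (8 / 7) := by
        rw [← Real.log_div (by positivity) (by norm_num)]
        congr 1
        ring
      rw [hl, ← add_mul]
      gcongr
      linarith


theorem stmt15 :
    ∃ C : ℝ, 0 < C ∧
      ∀ (H : Type) [NormedAddCommGroup H] [InnerProductSpace ℂ H] [CompleteSpace H]
        (A B R : H →L[ℂ] H), IsSelfAdjoint A → IsSelfAdjoint B →
        ∀ n : ℕ, 1 ≤ n → (spectrum ℝ A).Finite → (spectrum ℝ A).ncard = n →
        ∀ L : ℝ, 0 ≤ L →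
        ∀ f : ℝ → ℂ, Continuous f →
          (∀ x ∈ spectrum ℝ A ∪ spectrum ℝ B, ∀ y ∈ spectrum ℝ A ∪ spectrum ℝ B,
            ‖f x - f y‖ ≤ L * |x - y|) →
          ‖cfcC f A * R - R * cfcC f B‖ ≤
            C * (1 + Real.log n) * L * ‖A * R - R * B‖ := by
  obtain ⟨C, hC, h⟩ := exists_norm_finiteSpectralProj_mul_le_log
  refine ⟨C, hC, ?_⟩
  intro H _ _ _ A B R hA hB n _ hfin hn L hL f hf hlip
  have hproj : finiteSpectralProj A (hfin.toFinset : Set ℝ) = 1 := by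
    rw [finiteSpectralProj, cfcC_congr hA (g := fun _ => 1) fun x hx => by simp [hx],
      cfcC_const hA, one_smul]
  have key := h H A B R hA hB hfin f L hf hL hlip hfin.toFinset (by simp)
  rwa [hproj, one_mul, ← Set.ncard_eq_toFinset_card _ hfin, hn, ← mul_assoc] at key
end
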